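/- Let q be a power of a prime and F_q the finite field with q elements. Let A ⊆ F_q \ {0} with |A| ≥ 2 and let δ > 0. Suppose there is a constant C > 0 such that for every proper subfield G of F_q and every c ∈ F_q one has |A ∩ cG| ≤ C·max{|G|^{1/2}, |A|^{1-δ}}. Then there is a constant C' > 0 depending only on C and δ such that E_×(A) ≤ C'·log|A|·max{|A + A|^{7/4}|A|, |A + A|^{6/5}|A|^{8/5}, |A|^{3 - δ/2}, |A + A|^{7/4}|A|^{3/2}q^{-1/4}}, and the same estimate holds with the sum set A + A replaced by the difference set A − A. -/

import Mathlib

open scoped Classical Pointwise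

noncomputable section

namespace STP

variable {F : Type} [Field F]

def collinearTriples (A B : Finset F) : ℕ :=
  (((A ×ˢ A ×ˢ A) ×ˢ (B ×ˢ B ×ˢ B)).filter fun x =>
    (x.1.2.1 - x.1.1) * (x.2.2.2 - x.2.1) = (x.1.2.2 - x.1.1) * (x.2.2.1 - x.2.1)).card

def IsLine (l : Set (F × F)) : Prop :=
  ∃ a b c : F, (a, b) ≠ (0, 0) ∧ l = {p : F × F | a * p.1 + b * p.2 = c}

def incidences (P : Finset (F × F)) (L : Finset (Set (F × F))) : ℕ :=
  ((P ×ˢ L).filter fun x => x.1 ∈ x.2).card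

def kIncidences (P : Finset (F × F)) (L : Finset (Set (F × F))) (k : ℕ) : ℕ :=
  (((Fintype.piFinset fun _ : Fin k => P) ×ˢ L).filter fun x => ∀ i, x.1 i ∈ x.2).card

def numLines (P : Finset (F × F)) : ℕ :=
  Set.ncard {l : Set (F × F) | IsLine l ∧ 2 ≤ (P.filter (· ∈ l)).card}

def addEnergy (X Y : Finset F) : ℕ :=
  (((X ×ˢ X) ×ˢ (Y ×ˢ Y)).filter fun t => t.1.1 + t.2.1 = t.1.2 + t.2.2).card

def mulEnergy (A : Finset F) : ℕ :=
  (((A ×ˢ A) ×ˢ (A ×ˢ A)).filter fun t => t.1.1 * t.2.1 = t.1.2 * t.2.2).card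

def quotSet (X : Finset F) : Set F :=
  {r : F | ∃ x1 ∈ X, ∃ x2 ∈ X, ∃ x3 ∈ X, ∃ x4 ∈ X, x3 ≠ x4 ∧ r = (x1 - x2) / (x3 - x4)}

def subfieldCond (A : Finset F) (C bound : ℝ) : Prop :=
  ∀ G : Subfield F, G ≠ ⊤ → ∀ c d : F,
    ((A.filter fun x => ∃ g ∈ G, x = c * g + d).card : ℝ) ≤
      C * max ((Nat.card G : ℝ) ^ ((1:ℝ)/2)) bound

def linesOf [Fintype F] (P : Finset (F × F)) : Finset (Set (F × F)) :=
  Set.Finite.toFinset (Set.toFinite {l : Set (F × F) | IsLine l ∧ 2 ≤ (P.filter (· ∈ l)).card})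

def tripleCount [Fintype F] (P : Finset (F × F)) : ℕ :=
  ∑ l ∈ linesOf P, ((P.filter (· ∈ l)).card) ^ 3


/-! ### Plünnecke type lemmas -/

lemma petridis_min {G : Type*} [AddCommGroup G] [DecidableEq G] (X B : Finset G)
    (hX : X.Nonempty) :
    ∃ X' ⊆ X, X'.Nonempty ∧ (X' + B).card * X.card ≤ (X + B).card * X'.card ∧
      ∀ C : Finset G, (C + X' + B).card * X'.card ≤ (X' + B).card * (C + X').card := by
  obtain ⟨X', hX', hmin⟩ := Finset.exists_min_image (X.powerset.erase ∅)
    (fun C => ((C + B).card : ℚ) / C.card) ⟨X, by simp [hX.ne_empty]⟩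
  have hne : X'.Nonempty := by
    rw [Finset.nonempty_iff_ne_empty]; exact (Finset.mem_erase.1 hX').1
  have hsub : X' ⊆ X := Finset.mem_powerset.1 (Finset.mem_erase.1 hX').2
  have key : ∀ A' ⊆ X, (X' + B).card * A'.card ≤ (A' + B).card * X'.card := by
    intro A' hA'
    rcases A'.eq_empty_or_nonempty with rfl | hA
    · simp
    · have h := hmin A' (by simp [hA.ne_empty, hA'])
      have h1 : (0:ℚ) < X'.card := by exact_mod_cast hne.card_pos
      have h2 : (0:ℚ) < A'.card := by exact_mod_cast hA.card_pos
      rw [div_le_div_iff₀ h1 h2] at h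
      exact_mod_cast h
  exact ⟨X', hsub, hne, key X subset_rfl, fun C =>
    Finset.pluennecke_petridis_inequality_add C (fun A' hA' => key A' (hA'.trans hsub))⟩

/-- Plünnecke with two different summands. -/
lemma plun_two {G : Type*} [AddCommGroup G] [DecidableEq G] (X Y₁ Y₂ : Finset G)
    (hX : X.Nonempty) (hY₁ : Y₁.Nonempty) (hY₂ : Y₂.Nonempty) :
    ∃ X' ⊆ X, X'.Nonempty ∧
      (X' + Y₁ + Y₂).card * X.card ^ 2 ≤ 4 * (X + Y₁).card * (X + Y₂).card * X'.card := by
  set p₁ := (X + Y₁).card with hp₁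
  set p₂ := (X + Y₂).card with hp₂
  have hp₁0 : 0 < p₁ := (hX.add hY₁).card_pos
  have hp₂0 : 0 < p₂ := (hX.add hY₂).card_pos
  let I₁ : Finset ℤ := (Finset.range p₂).image (fun k : ℕ => (k : ℤ))
  let I₂ : Finset ℤ := (Finset.range p₁).image (fun k : ℕ => (k : ℤ))
  have hI₁ : I₁.card = p₂ := by
    rw [Finset.card_image_of_injective _ Nat.cast_injective, Finset.card_range]
  have hI₂ : I₂.card = p₁ := by
    rw [Finset.card_image_of_injective _ Nat.cast_injective, Finset.card_range]
  let Z : Finset (G × ℤ × ℤ) := X ×ˢ ({0} : Finset ℤ) ×ˢ ({0} : Finset ℤ)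
  let W₁ : Finset (G × ℤ × ℤ) := Y₁ ×ˢ I₁ ×ˢ ({0} : Finset ℤ)
  let W₂ : Finset (G × ℤ × ℤ) := Y₂ ×ˢ ({0} : Finset ℤ) ×ˢ I₂
  have hZc : Z.card = X.card := by simp [Z]
  have hZW₁ : (Z + W₁).card ≤ p₁ * p₂ := by
    have : Z + W₁ ⊆ (X + Y₁) ×ˢ I₁ ×ˢ ({0} : Finset ℤ) := by
      intro t ht
      obtain ⟨a, ha, b, hb, rfl⟩ := Finset.mem_add.1 ht
      simp only [Z, W₁, Finset.mem_product, Finset.mem_singleton] at ha hb ⊢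
      refine ⟨Finset.add_mem_add ha.1 hb.1, ?_, ?_⟩
      · simpa [ha.2.1] using hb.2.1
      · simp [ha.2.2, hb.2.2]
    refine (Finset.card_le_card this).trans ?_
    simp [hI₁, hp₁]
  have hZW₂ : (Z + W₂).card ≤ p₁ * p₂ := by
    have : Z + W₂ ⊆ (X + Y₂) ×ˢ ({0} : Finset ℤ) ×ˢ I₂ := by
      intro t ht
      obtain ⟨a, ha, b, hb, rfl⟩ := Finset.mem_add.1 ht
      simp only [Z, W₂, Finset.mem_product, Finset.mem_singleton] at ha hb ⊢
      refine ⟨Finset.add_mem_add ha.1 hb.1, ?_, ?_⟩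
      · simp [ha.2.1, hb.2.1]
      · simpa [ha.2.2] using hb.2.2
    refine (Finset.card_le_card this).trans ?_
    simp [hI₂, hp₂, mul_comm]
  have hZW : (Z + (W₁ ∪ W₂)).card ≤ 2 * (p₁ * p₂) := by
    rw [Finset.add_union]
    refine (Finset.card_union_le _ _).trans ?_
    omega
  obtain ⟨Z', hZ', hZne, hr, hC⟩ := petridis_min Z (W₁ ∪ W₂) (by
    obtain ⟨x, hx⟩ := hX
    exact ⟨(x, 0, 0), by simp [Z, hx]⟩)
  set W := W₁ ∪ W₂ with hW
  let X' : Finset G := Z'.image Prod.fst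
  have hZmem : ∀ t ∈ Z', t.2.1 = 0 ∧ t.2.2 = 0 ∧ t.1 ∈ X := by
    intro t ht
    have := hZ' ht
    simp only [Z, Finset.mem_product, Finset.mem_singleton] at this
    exact ⟨this.2.1, this.2.2, this.1⟩
  have hcard : X'.card = Z'.card := by
    apply Finset.card_image_of_injOn
    intro a ha b hb hab
    have h1 := hZmem a ha
    have h2 := hZmem b hb
    ext
    · exact hab
    · rw [h1.1, h2.1]
    · rw [h1.2.1, h2.2.1]
  have hbig : (X' + Y₁ + Y₂).card * (p₁ * p₂) ≤ (W + Z' + W).card := by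
    have hs : (X' + Y₁ + Y₂) ×ˢ I₁ ×ˢ I₂ ⊆ W + Z' + W := by
      rintro ⟨g, i, j⟩ ht
      simp only [Finset.mem_product] at ht
      obtain ⟨hg, hi, hj⟩ := ht
      obtain ⟨a, ha, y₂, hy₂, rfl⟩ := Finset.mem_add.1 hg
      obtain ⟨x, hx, y₁, hy₁, rfl⟩ := Finset.mem_add.1 ha
      obtain ⟨z, hz, rfl⟩ := Finset.mem_image.1 hx
      have h1 := hZmem z hz
      refine Finset.mem_add.2 ⟨(y₁, i, 0) + z, Finset.add_mem_add ?_ hz, (y₂, 0, j), ?_, ?_⟩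
      · apply Finset.mem_union_left
        simp [W₁, hy₁, hi]
      · apply Finset.mem_union_right
        simp [W₂, hy₂, hj]
      · ext
        · simp; abel
        · simp [h1.1]
        · simp [h1.2.1]
    have := Finset.card_le_card hs
    rw [Finset.card_product, Finset.card_product, hI₁, hI₂] at this
    rwa [mul_comm p₁ p₂]
  have h1 := hC W
  rw [add_comm W Z'] at h1
  rw [add_comm W Z'] at hbig
  refine ⟨X', ?_, hZne.image _, ?_⟩
  · intro x hx
    obtain ⟨z, hz, rfl⟩ := Finset.mem_image.1 hx
    exact (hZmem z hz).2.2
  rw [hcard]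
  rw [hZc] at hr
  have hz0 : 0 < Z'.card := hZne.card_pos
  set a := (X' + Y₁ + Y₂).card
  set b := (Z' + W + W).card
  set c := (Z' + W).card
  set x := X.card
  set z := Z'.card
  have hx : c * x ≤ 2 * (p₁ * p₂) * z := hr.trans (Nat.mul_le_mul_right _ hZW)
  have h2 : (a * x ^ 2) * (p₁ * p₂ * z) ≤ (4 * p₁ * p₂ * z) * (p₁ * p₂ * z) := by
    calc (a * x ^ 2) * (p₁ * p₂ * z) = (a * (p₁ * p₂)) * z * x ^ 2 := by ring
      _ ≤ b * z * x ^ 2 := by gcongr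
      _ ≤ c * c * x ^ 2 := by gcongr
      _ = (c * x) ^ 2 := by ring
      _ ≤ (2 * (p₁ * p₂) * z) ^ 2 := by gcongr
      _ = _ := by ring
  exact Nat.le_of_mul_le_mul_right h2 (by positivity)

/-- A large subset with controlled fourfold sumset. -/
lemma plun_large {G : Type*} [AddCommGroup G] [DecidableEq G] (R B : Finset G) (S : ℕ)
    (hS : (R + B).card ≤ S) :
    ∃ R' ⊆ R, 16 * (R \ R').card ≤ R.card ∧
      (R' + B + B + B).card * R.card ^ 2 ≤ 4096 * S ^ 3 := by
  let Φ : Finset (Finset G) := R.powerset.filter fun Q =>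
    (Q + B + B + B).card * R.card ^ 3 ≤ 4096 * S ^ 3 * Q.card
  obtain ⟨R', hR', hmax⟩ := Finset.exists_max_image Φ Finset.card ⟨∅, by simp [Φ]⟩
  simp only [Φ, Finset.mem_filter, Finset.mem_powerset] at hR' hmax
  refine ⟨R', hR'.1, ?_, ?_⟩
  · by_contra hlt
    push Not at hlt
    have hne : (R \ R').Nonempty := by
      rw [← Finset.card_pos]; omega
    obtain ⟨X, hX, hXne, hr, hC⟩ := petridis_min (R \ R') B hne
    have hXR : X ⊆ R := hX.trans Finset.sdiff_subset
    have hx0 : 0 < X.card := hXne.card_pos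
    have hdisj : Disjoint R' X := by
      rw [Finset.disjoint_left]
      intro a ha hb
      exact (Finset.mem_sdiff.1 (hX hb)).2 ha
    have hk : (X + B).card * R.card ≤ 16 * S * X.card := by
      have h1 : (X + B).card * (R \ R').card ≤ S * X.card :=
        hr.trans (Nat.mul_le_mul_right _ ((Finset.card_le_card
          (Finset.add_subset_add_right Finset.sdiff_subset)).trans hS))
      nlinarith
    have h1 : (X + B + B).card * X.card ≤ (X + B).card * (X + B).card := by
      have := hC B
      rwa [add_comm B X] at this
    have h2 : (X + B + B + B).card * X.card ≤ (X + B).card * (X + B + B).card := by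
      have := hC (B + B)
      rwa [add_comm (B + B) X, ← add_assoc] at this
    have h3 : (X + B + B + B).card * R.card ^ 3 ≤ 4096 * S ^ 3 * X.card := by
      have : ((X + B + B + B).card * R.card ^ 3) * X.card ^ 2 ≤
          (4096 * S ^ 3 * X.card) * X.card ^ 2 := by
        calc ((X + B + B + B).card * R.card ^ 3) * X.card ^ 2
            = ((X + B + B + B).card * X.card) * X.card * R.card ^ 3 := by ring
          _ ≤ ((X + B).card * (X + B + B).card) * X.card * R.card ^ 3 := by gcongr
          _ = (X + B).card * ((X + B + B).card * X.card) * R.card ^ 3 := by ring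
          _ ≤ (X + B).card * ((X + B).card * (X + B).card) * R.card ^ 3 := by gcongr
          _ = ((X + B).card * R.card) ^ 3 := by ring
          _ ≤ (16 * S * X.card) ^ 3 := by gcongr
          _ = _ := by ring
      exact Nat.le_of_mul_le_mul_right this (by positivity)
    have h4 := hmax (R' ∪ X) ⟨Finset.union_subset hR'.1 hXR, by
      rw [Finset.card_union_of_disjoint hdisj, Finset.union_add, Finset.union_add,
        Finset.union_add]
      have := Finset.card_union_le (R' + B + B + B) (X + B + B + B)
      nlinarith [Nat.zero_le (R.card ^ 3)]⟩
    rw [Finset.card_union_of_disjoint hdisj] at h4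
    omega
  · rcases R.eq_empty_or_nonempty with rfl | hne
    · simp
    have h0 : 0 < R.card := hne.card_pos
    have h1 : (R' + B + B + B).card * R.card ^ 2 * R.card ≤ 4096 * S ^ 3 * R.card := by
      calc _ = (R' + B + B + B).card * R.card ^ 3 := by ring
        _ ≤ _ := hR'.2
        _ ≤ _ := by gcongr; exact hR'.1
    exact Nat.le_of_mul_le_mul_right h1 h0

/-- Ruzsa triangle inequalities, both signs. -/
lemma ruzsa_gen (Z V W : Finset F) (θ : F) (hθ : θ = 1 ∨ θ = -1) :
    (Z + V).card * W.card ≤ (Z + W).card * (V + θ • W).card := by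
  rcases hθ with rfl | rfl
  · rw [one_smul, add_comm V W]
    exact Finset.ruzsa_triangle_inequality_add_add_add Z W V
  · have h := Finset.ruzsa_triangle_inequality_sub_add_add Z W (-V)
    rw [sub_neg_eq_add] at h
    have h2 : V + (-1 : F) • W = -(-V + W) := by
      ext t
      simp only [Finset.mem_add, Finset.mem_neg, Finset.mem_smul_finset]
      constructor
      · rintro ⟨v, hv, w, ⟨w', hw', rfl⟩, rfl⟩
        refine ⟨-v + w', ⟨-v, ⟨v, hv, rfl⟩, w', hw', rfl⟩, by simp [add_comm]⟩
      · rintro ⟨s, ⟨a, ⟨v, hv, rfl⟩, w, hw, rfl⟩, rfl⟩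
        exact ⟨v, hv, _, ⟨w, hw, rfl⟩, by simp [add_comm]⟩
    rw [h2, Finset.card_neg]
    exact h


/-! ### Replacing popular dilates -/

/-- elements `a` of `A` with `ξ a ∈ A`. -/
def fib (A : Finset F) (ξ : F) : Finset F := A.filter fun a => ξ * a ∈ A

lemma sign_ne {σ : F} (h : σ = 1 ∨ σ = -1) : σ ≠ 0 := by
  rcases h with rfl | rfl <;> simp

lemma sign_sq {σ : F} (h : σ = 1 ∨ σ = -1) : σ * σ = 1 := by
  rcases h with rfl | rfl <;> simp

lemma sign_mul {σ τ : F} (h : σ = 1 ∨ σ = -1) (h' : τ = 1 ∨ τ = -1) :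
    σ * τ = 1 ∨ σ * τ = -1 := by
  rcases h with rfl | rfl <;> rcases h' with rfl | rfl <;> simp

lemma smul_fib_subset (A : Finset F) (ξ : F) : ξ • fib A ξ ⊆ A := by
  intro t ht
  obtain ⟨a, ha, rfl⟩ := Finset.mem_smul_finset.1 ht
  exact (Finset.mem_filter.1 ha).2

lemma repl_step (A U Z : Finset F) (hU : U ⊆ A) (ξ σ τ τ' : F) (hξ : ξ ≠ 0)
    (hσ : σ = 1 ∨ σ = -1) (hτ : τ = 1 ∨ τ = -1) (hτ' : τ' = 1 ∨ τ' = -1) :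
    (Z + τ • ξ • U).card * (fib A ξ).card ≤ (Z + τ' • A).card * (A + σ • A).card := by
  have h := ruzsa_gen Z (τ • ξ • U) (τ' • ξ • fib A ξ) (σ * τ * τ')
    (sign_mul (sign_mul hσ hτ) hτ')
  rw [Finset.card_smul_finset₀ (sign_ne hτ'), Finset.card_smul_finset₀ hξ] at h
  refine h.trans (Nat.mul_le_mul ?_ ?_)
  · exact Finset.card_le_card (Finset.add_subset_add_left
      (Finset.smul_finset_subset_smul_finset (smul_fib_subset A ξ)))
  · have e : τ • ξ • U + (σ * τ * τ') • τ' • ξ • fib A ξ = (τ * ξ) • (U + σ • fib A ξ) := by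
      rw [DistribSMul.smul_add]
      simp only [smul_smul]
      congr 2
      calc σ * τ * τ' * (τ' * ξ) = σ * τ * ξ * (τ' * τ') := by ring
        _ = τ * ξ * σ := by rw [sign_sq hτ']; ring
    rw [e, Finset.card_smul_finset₀ (mul_ne_zero (sign_ne hτ) hξ)]
    exact Finset.card_le_card (Finset.add_subset_add hU
      (Finset.smul_finset_subset_smul_finset (Finset.filter_subset _ _)))

lemma repl_three (A Z U₁ U₂ U₃ : Finset F) (h₁ : U₁ ⊆ A) (h₂ : U₂ ⊆ A) (h₃ : U₃ ⊆ A)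
    (ξ₁ ξ₂ ξ₃ σ τ₁ τ₂ τ₃ : F) (hξ₁ : ξ₁ ≠ 0) (hξ₂ : ξ₂ ≠ 0) (hξ₃ : ξ₃ ≠ 0)
    (hσ : σ = 1 ∨ σ = -1) (hτ₁ : τ₁ = 1 ∨ τ₁ = -1) (hτ₂ : τ₂ = 1 ∨ τ₂ = -1)
    (hτ₃ : τ₃ = 1 ∨ τ₃ = -1) (N S : ℕ) (hS : (A + σ • A).card ≤ S)
    (hN₁ : N ≤ (fib A ξ₁).card) (hN₂ : N ≤ (fib A ξ₂).card) (hN₃ : N ≤ (fib A ξ₃).card) :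
    (Z + τ₁ • ξ₁ • U₁ + τ₂ • ξ₂ • U₂ + τ₃ • ξ₃ • U₃).card * N ^ 3 ≤
      S ^ 3 * (Z + σ • A + σ • A + σ • A).card := by
  have a₁ := repl_step A U₃ (Z + τ₁ • ξ₁ • U₁ + τ₂ • ξ₂ • U₂) h₃ ξ₃ σ τ₃ σ hξ₃ hσ hτ₃ hσ
  have a₂ := repl_step A U₂ (Z + τ₁ • ξ₁ • U₁ + σ • A) h₂ ξ₂ σ τ₂ σ hξ₂ hσ hτ₂ hσ
  have a₃ := repl_step A U₁ (Z + σ • A + σ • A) h₁ ξ₁ σ τ₁ σ hξ₁ hσ hτ₁ hσ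
  rw [add_right_comm (Z + τ₁ • ξ₁ • U₁)] at a₂
  rw [show Z + σ • A + σ • A + τ₁ • ξ₁ • U₁ = Z + τ₁ • ξ₁ • U₁ + σ • A + σ • A by abel] at a₃
  set c₀ := (Z + τ₁ • ξ₁ • U₁ + τ₂ • ξ₂ • U₂ + τ₃ • ξ₃ • U₃).card
  set c₁ := (Z + τ₁ • ξ₁ • U₁ + τ₂ • ξ₂ • U₂ + σ • A).card
  set c₂ := (Z + τ₁ • ξ₁ • U₁ + σ • A + σ • A).card
  set c₃ := (Z + σ • A + σ • A + σ • A).card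
  have b₁ : c₀ * N ≤ c₁ * S := (Nat.mul_le_mul_left _ hN₃).trans
    (a₁.trans (Nat.mul_le_mul_left _ hS))
  have b₂ : c₁ * N ≤ c₂ * S := (Nat.mul_le_mul_left _ hN₂).trans
    (a₂.trans (Nat.mul_le_mul_left _ hS))
  have b₃ : c₂ * N ≤ c₃ * S := (Nat.mul_le_mul_left _ hN₁).trans
    (a₃.trans (Nat.mul_le_mul_left _ hS))
  calc c₀ * N ^ 3 = (c₀ * N) * N * N := by ring
    _ ≤ (c₁ * S) * N * N := by gcongr
    _ = (c₁ * N) * S * N := by ring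
    _ ≤ (c₂ * S) * S * N := by gcongr
    _ = (c₂ * N) * S * S := by ring
    _ ≤ (c₃ * S) * S * S := by gcongr
    _ = _ := by ring

lemma sub_smul_subset (a b : F) (U : Finset F) : (a - b) • U ⊆ a • U + (-1 : F) • b • U := by
  intro t ht
  obtain ⟨u, hu, rfl⟩ := Finset.mem_smul_finset.1 ht
  refine Finset.mem_add.2 ⟨a * u, Finset.smul_mem_smul_finset (a := a) hu, (-1 : F) • b • u,
    Finset.smul_mem_smul_finset (Finset.smul_mem_smul_finset hu), ?_⟩
  simp only [smul_eq_mul]; ring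

/-- Bound with three replacements, when `ξ₁ U ⊆ A`. -/
lemma bound_three (A U V : Finset F) (hU : U ⊆ A) (hV : V ⊆ A)
    (ξ₁ ξ₂ ξ₃ ξ₄ σ : F) (hξ₂ : ξ₂ ≠ 0) (hξ₃ : ξ₃ ≠ 0) (hξ₄ : ξ₄ ≠ 0)
    (hσ : σ = 1 ∨ σ = -1) (N S : ℕ) (hS : (A + σ • A).card ≤ S)
    (hN₂ : N ≤ (fib A ξ₂).card) (hN₃ : N ≤ (fib A ξ₃).card) (hN₄ : N ≤ (fib A ξ₄).card)
    (hU₁ : ξ₁ • U ⊆ A) :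
    ((ξ₁ - ξ₂) • U + (ξ₃ - ξ₄) • V).card * N ^ 3 ≤
      S ^ 3 * (A + σ • A + σ • A + σ • A).card := by
  have h := repl_three A A U V V hU hV hV ξ₂ ξ₃ ξ₄ σ (-1) 1 (-1) hξ₂ hξ₃ hξ₄ hσ (Or.inr rfl)
    (Or.inl rfl) (Or.inr rfl) N S hS hN₂ hN₃ hN₄
  refine le_trans (Nat.mul_le_mul_right _ (Finset.card_le_card ?_)) h
  rw [one_smul, add_assoc (A + _)]
  exact Finset.add_subset_add ((sub_smul_subset _ _ _).trans
    (Finset.add_subset_add_right hU₁)) (sub_smul_subset _ _ _)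

/-- Bound with four replacements. -/
lemma bound_four (A U V : Finset F) (hU : U ⊆ A) (hV : V ⊆ A)
    (ξ₁ ξ₂ ξ₃ ξ₄ σ : F) (hξ₁ : ξ₁ ≠ 0) (hξ₂ : ξ₂ ≠ 0) (hξ₃ : ξ₃ ≠ 0) (hξ₄ : ξ₄ ≠ 0)
    (hσ : σ = 1 ∨ σ = -1) (N S : ℕ) (hS : (A + σ • A).card ≤ S)
    (hN₁ : N ≤ (fib A ξ₁).card)
    (hN₂ : N ≤ (fib A ξ₂).card) (hN₃ : N ≤ (fib A ξ₃).card) (hN₄ : N ≤ (fib A ξ₄).card) :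
    ((ξ₁ - ξ₂) • U + (ξ₃ - ξ₄) • V).card * N ^ 4 ≤
      S ^ 4 * (A + σ • A + σ • A + σ • A).card := by
  have h := repl_three A (ξ₁ • U) U V V hU hV hV ξ₂ ξ₃ ξ₄ σ (-1) 1 (-1) hξ₂ hξ₃ hξ₄ hσ
    (Or.inr rfl) (Or.inl rfl) (Or.inr rfl) N S hS hN₂ hN₃ hN₄
  have h' := repl_step A U (σ • A + σ • A + σ • A) hU ξ₁ σ 1 1 hξ₁ hσ (Or.inl rfl) (Or.inl rfl)
  rw [one_smul, one_smul, show σ • A + σ • A + σ • A + ξ₁ • U = ξ₁ • U + σ • A + σ • A + σ • A by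
    abel, show σ • A + σ • A + σ • A + A = A + σ • A + σ • A + σ • A by abel] at h'
  have h'' := (Nat.mul_le_mul_left _ hN₁).trans (h'.trans (Nat.mul_le_mul_left _ hS))
  have h3 : ((ξ₁ - ξ₂) • U + (ξ₃ - ξ₄) • V).card * N ^ 3 ≤
      S ^ 3 * (ξ₁ • U + σ • A + σ • A + σ • A).card := by
    refine le_trans (Nat.mul_le_mul_right _ (Finset.card_le_card ?_)) h
    rw [one_smul, add_assoc (ξ₁ • U + _)]
    exact Finset.add_subset_add (sub_smul_subset _ _ _) (sub_smul_subset _ _ _)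
  calc _ = (((ξ₁ - ξ₂) • U + (ξ₃ - ξ₄) • V).card * N ^ 3) * N := by ring
    _ ≤ (S ^ 3 * (ξ₁ • U + σ • A + σ • A + σ • A).card) * N := by gcongr
    _ = S ^ 3 * ((ξ₁ • U + σ • A + σ • A + σ • A).card * N) := by ring
    _ ≤ S ^ 3 * ((A + σ • A + σ • A + σ • A).card * S) := by gcongr
    _ = _ := by ring

/-- Pigeonhole: a small sumset `U + r V` gives a representation of `r`. -/
lemma rep_of_small (U V : Finset F) (r : F) (h : (U + r • V).card < U.card * V.card) :
    ∃ u ∈ U, ∃ u' ∈ U, ∃ v ∈ V, ∃ v' ∈ V, v ≠ v' ∧ r = (u - u') / (v - v') := by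
  have hmaps : ∀ p ∈ U ×ˢ V, p.1 + r * p.2 ∈ U + r • V := by
    intro p hp
    rw [Finset.mem_product] at hp
    exact Finset.add_mem_add hp.1 (Finset.smul_mem_smul_finset (a := r) hp.2)
  rw [← Finset.card_product] at h
  obtain ⟨p, hp, p', hp', hne, he⟩ := Finset.exists_ne_map_eq_of_card_lt_of_maps_to h hmaps
  rw [Finset.mem_product] at hp hp'
  have hv : p.2 ≠ p'.2 := by
    intro hv
    apply hne
    have : p.1 = p'.1 := by
      rw [hv] at he
      exact add_right_cancel he
    exact Prod.ext this hv
  refine ⟨p'.1, hp'.1, p.1, hp.1, p.2, hp.2, p'.2, hp'.2, hv, ?_⟩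
  rw [eq_div_iff (sub_ne_zero.2 hv)]
  linear_combination he

lemma card_add_smul_scale (U V : Finset F) (r a b : F) (hb : b ≠ 0) (hr : r = a / b) :
    (U + r • V).card = (a • V + b • U).card := by
  rw [← Finset.card_smul_finset₀ hb (U + r • V), DistribSMul.smul_add, smul_smul, hr,
    mul_div_cancel₀ _ hb, add_comm]


/-! ### Popularity and counting -/

lemma popular {ι : Type*} (A : Finset ι) (f : ι → ℕ) (n k e : ℕ) (hn : 0 < n) (hA : A.card ≤ n)
    (h : e ≤ k * ∑ a ∈ A, f a) :
    e ≤ 2 * k * ∑ a ∈ A.filter (fun a => e ≤ 2 * k * n * f a), f a := by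
  have hs := Finset.sum_filter_add_sum_filter_not A (fun a => e ≤ 2 * k * n * f a) f
  set P := ∑ a ∈ A.filter (fun a => e ≤ 2 * k * n * f a), f a
  set Q := ∑ a ∈ A.filter (fun a => ¬ e ≤ 2 * k * n * f a), f a with hQ
  have h1 : 2 * k * n * Q ≤ e * n := by
    rw [hQ, Finset.mul_sum]
    calc _ ≤ ∑ a ∈ A.filter (fun a => ¬ e ≤ 2 * k * n * f a), e := by
          apply Finset.sum_le_sum
          intro a ha
          have := (Finset.mem_filter.1 ha).2
          omega
      _ = (A.filter (fun a => ¬ e ≤ 2 * k * n * f a)).card * e := by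
          rw [Finset.sum_const, smul_eq_mul]
      _ ≤ n * e := Nat.mul_le_mul_right _ ((Finset.card_filter_le _ _).trans hA)
      _ = _ := mul_comm _ _
  have h2 : 2 * k * Q ≤ e := by
    apply Nat.le_of_mul_le_mul_right _ hn
    calc _ = 2 * k * n * Q := by ring
      _ ≤ _ := h1
  rw [← hs, mul_add] at h
  have h3 : 2 * k * P = 2 * (k * P) := by ring
  have h4 : 2 * k * Q = 2 * (k * Q) := by ring
  omega

/-- neighbours of `y` with respect to the set of slopes `Ξ`. -/
def nb (A Ξ : Finset F) (y : F) : Finset F := A.filter fun u => u / y ∈ Ξ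

lemma nb_subset (A Ξ : Finset F) (y : F) : nb A Ξ y ⊆ A := Finset.filter_subset _ _

lemma mem_nb {A Ξ : Finset F} {y u : F} : u ∈ nb A Ξ y ↔ u ∈ A ∧ u / y ∈ Ξ := by
  simp [nb]

lemma count_nb (A Ξ Z : Finset F) (h0 : (0:F) ∉ A) (hZ : Z ⊆ A) :
    ∑ ξ ∈ Ξ, ((fib A ξ).filter (· ∈ Z)).card = ∑ y ∈ Z, (nb A Ξ y).card := by
  have h1 : ∀ ξ ∈ Ξ, ((fib A ξ).filter (· ∈ Z)).card =
      (Finset.bipartiteAbove (fun ξ z : F => ξ * z ∈ A) Z ξ).card := by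
    intro ξ _
    congr 1
    ext z
    simp only [fib, Finset.mem_filter, Finset.bipartiteAbove]
    constructor
    · rintro ⟨⟨_, h⟩, h'⟩; exact ⟨h', h⟩
    · rintro ⟨h', h⟩; exact ⟨⟨hZ h', h⟩, h'⟩
  have h2 : ∀ y ∈ Z, (nb A Ξ y).card =
      (Finset.bipartiteBelow (fun ξ z : F => ξ * z ∈ A) Ξ y).card := by
    intro y hy
    have hy0 : y ≠ 0 := fun h => h0 (h ▸ hZ hy)
    refine Finset.card_bij' (fun u _ => u / y) (fun ξ _ => ξ * y) ?_ ?_ ?_ ?_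
    · intro u hu
      rw [mem_nb] at hu
      simp only [Finset.bipartiteBelow, Finset.mem_filter]
      refine ⟨hu.2, ?_⟩
      rw [div_mul_cancel₀ _ hy0]; exact hu.1
    · intro ξ hξ
      simp only [Finset.bipartiteBelow, Finset.mem_filter] at hξ
      rw [mem_nb]
      refine ⟨hξ.2, ?_⟩
      rw [mul_div_cancel_right₀ _ hy0]; exact hξ.1
    · intro u _
      exact div_mul_cancel₀ _ hy0
    · intro ξ _
      exact mul_div_cancel_right₀ _ hy0
  rw [Finset.sum_congr rfl h1, Finset.sum_congr rfl h2]
  exact Finset.sum_card_bipartiteAbove_eq_sum_card_bipartiteBelow _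

/-! ### The quotient set of the popular slopes -/

lemma rep_of_mem (A Ξ U V : Finset F) (hU : U ⊆ A) (hV : V ⊆ A) (σ : F)
    (hσ : σ = 1 ∨ σ = -1) (N S : ℕ) (hS : (A + σ • A).card ≤ S)
    (hΞ0 : ∀ ξ ∈ Ξ, ξ ≠ 0) (hΞN : ∀ ξ ∈ Ξ, N ≤ (fib A ξ).card)
    (h : S ^ 4 * (A + σ • A + σ • A + σ • A).card < U.card * V.card * N ^ 4)
    (r : F) (hr : r ∈ quotSet Ξ) :
    ∃ u ∈ U, ∃ u' ∈ U, ∃ v ∈ V, ∃ v' ∈ V, v ≠ v' ∧ r = (u - u') / (v - v') := by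
  obtain ⟨x1, h1, x2, h2, x3, h3, x4, h4, hne, rfl⟩ := hr
  apply rep_of_small
  rw [card_add_smul_scale U V _ (x1 - x2) (x3 - x4) (sub_ne_zero.2 hne) rfl]
  have := bound_four A V U hV hU x1 x2 x3 x4 σ (hΞ0 _ h1) (hΞ0 _ h2) (hΞ0 _ h3) (hΞ0 _ h4) hσ N S
    hS (hΞN _ h1) (hΞN _ h2) (hΞN _ h3) (hΞN _ h4)
  exact Nat.lt_of_mul_lt_mul_right (this.trans_lt h)

lemma quot_neg (Ξ : Finset F) (r : F) (hr : r ∈ quotSet Ξ) : -r ∈ quotSet Ξ := by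
  obtain ⟨x1, h1, x2, h2, x3, h3, x4, h4, hne, rfl⟩ := hr
  refine ⟨x2, h2, x1, h1, x3, h3, x4, h4, hne, ?_⟩
  rw [← neg_div, neg_sub]

/-- A set with closure properties contains a subfield. -/
lemma exists_subfield [Fintype F] (R : Set F) (h0 : (0:F) ∈ R) (hneg : ∀ r ∈ R, -r ∈ R) (σ : F)
    (hσ : σ = 1 ∨ σ = -1) (hadd : ∀ r ∈ R, r + σ ∈ R) (M : Set F)
    (hM0 : ∀ m ∈ M, m ≠ 0) (hM : ∀ m ∈ M, ∀ r ∈ R, m * r ∈ R)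
    (hM' : ∀ m ∈ M, ∀ r ∈ R, m⁻¹ * r ∈ R) :
    ∃ G : Subfield F, (∀ g ∈ G, g ∈ R) ∧ ∀ m ∈ M, m ∈ G := by
  let H : Set F := {g | ∀ r ∈ R, r + g ∈ R}
  have Hneg : ∀ g ∈ H, -g ∈ H := by
    intro g hg r hr
    have := hneg _ (hg _ (hneg _ hr))
    rwa [neg_add, neg_neg] at this
  have Hadd : ∀ g ∈ H, ∀ g' ∈ H, g + g' ∈ H := by
    intro g hg g' hg' r hr
    rw [← add_assoc]
    exact hg' _ (hg _ hr)
  have H0 : (0:F) ∈ H := fun r hr => by simpa using hr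
  have H1 : (1:F) ∈ H := by
    rcases hσ with rfl | rfl
    · exact hadd
    · have : (-1 : F) ∈ H := hadd
      simpa using Hneg _ this
  have HR : ∀ g ∈ H, g ∈ R := fun g hg => by simpa using hg 0 h0
  have HM : ∀ m ∈ M, ∀ g ∈ H, m * g ∈ H := by
    intro m hm g hg r hr
    have := hM m hm _ (hg _ (hM' m hm r hr))
    rwa [mul_add, mul_inv_cancel_left₀ (hM0 m hm)] at this
  let G₀ : Subring F :=
    { carrier := {g | ∀ h ∈ H, g * h ∈ H}
      mul_mem' := by
        intro a b ha hb h hh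
        rw [mul_assoc]
        exact ha _ (hb _ hh)
      one_mem' := by
        intro h hh
        rwa [one_mul]
      add_mem' := by
        intro a b ha hb h hh
        rw [add_mul]
        exact Hadd _ (ha _ hh) _ (hb _ hh)
      zero_mem' := by
        intro h hh
        rw [zero_mul]
        exact H0
      neg_mem' := by
        intro a ha h hh
        rw [neg_mul]
        exact Hneg _ (ha _ hh) }
  let G : Subfield F :=
    { G₀ with
      inv_mem' := by
        intro x hx
        by_cases hx0 : x = 0
        · rw [hx0, inv_zero]; exact G₀.zero_mem
        have h1 : x ^ (Fintype.card F - 1) = 1 := FiniteField.pow_card_sub_one_eq_one x hx0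
        have h2 : x⁻¹ = x ^ (Fintype.card F - 2) := by
          have h3 : 1 < Fintype.card F := Fintype.one_lt_card
          have h4 : Fintype.card F - 1 = (Fintype.card F - 2) + 1 := by omega
          rw [h4, pow_succ] at h1
          exact (eq_inv_of_mul_eq_one_left h1).symm
        rw [h2]
        exact G₀.pow_mem hx _ }
  refine ⟨G, ?_, ?_⟩
  · intro g hg
    have : g * 1 ∈ H := (show ∀ h ∈ H, g * h ∈ H from hg) 1 H1
    rw [mul_one] at this
    exact HR _ this
  · intro m hm
    exact fun h hh => HM m hm h hh


/-! ### The core lemma -/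

lemma mul_closed (A Ξ : Finset F) (σ : F)
    (hσ : σ = 1 ∨ σ = -1) (N S : ℕ) (hS : (A + σ • A).card ≤ S)
    (hΞ0 : ∀ ξ ∈ Ξ, ξ ≠ 0) (hΞN : ∀ ξ ∈ Ξ, N ≤ (fib A ξ).card) (y y' : F) (hy : y ≠ 0)
    (hy' : y' ≠ 0)
    (h : S ^ 4 * (A + σ • A + σ • A + σ • A).card <
      (nb A Ξ y).card * (nb A Ξ y').card * N ^ 4)
    (r : F) (hr : r ∈ quotSet Ξ) : (y' / y) * r ∈ quotSet Ξ := by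
  obtain ⟨u, hu, u', hu', v, hv, v', hv', hne, rfl⟩ :=
    rep_of_mem A Ξ _ _ (nb_subset A Ξ y) (nb_subset A Ξ y') σ hσ N S hS hΞ0 hΞN h r hr
  refine ⟨u / y, (mem_nb.1 hu).2, u' / y, (mem_nb.1 hu').2, v / y', (mem_nb.1 hv).2,
    v' / y', (mem_nb.1 hv').2, ?_, ?_⟩
  · intro he
    exact hne ((div_left_inj' hy').1 he)
  · have : v - v' ≠ 0 := sub_ne_zero.2 hne
    rw [← sub_div, ← sub_div]
    field_simp

lemma add_closed (A Ξ Ξ' U : Finset F) (σ : F)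
    (hσ : σ = 1 ∨ σ = -1) (N S n e : ℕ) (hS : (A + σ • A).card ≤ S)
    (hΞ0 : ∀ ξ ∈ Ξ, ξ ≠ 0) (hΞN : ∀ ξ ∈ Ξ, N ≤ (fib A ξ).card) (hN : 0 < N) (he : 0 < e)
    (hΞ' : Ξ' ⊆ Ξ)
    (hU : U ⊆ A) (y₂ : F) (hy₂ : y₂ ≠ 0) (hUΞ : ∀ u ∈ U, u / y₂ ∈ Ξ')
    (hUc : e ≤ 8 * n * U.card)
    (hi : 64 * S ^ 4 * (A + σ • A + σ • A + σ • A).card * n ^ 2 < e ^ 2 * N ^ 4)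
    (hii : 512 * S ^ 4 * (A + σ • A + σ • A + σ • A).card * n ^ 4 < e ^ 3 * N ^ 4)
    (hrich : ∀ ξ ∈ Ξ', ∃ y : F, y ≠ 0 ∧ e ≤ 2 * n * (nb A Ξ y).card ∧
      e * N ≤ 32 * n ^ 2 * ((fib A ξ).filter (· ∈ nb A Ξ y)).card)
    (r : F) (hr : r ∈ quotSet Ξ) : r + σ ∈ quotSet Ξ := by
  set Q := (A + σ • A + σ • A + σ • A).card with hQ
  have hUU : S ^ 4 * Q < U.card * U.card * N ^ 4 := by
    have h1 : e ^ 2 * N ^ 4 ≤ (8 * n * U.card) ^ 2 * N ^ 4 := by gcongr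
    have h2 : S ^ 4 * Q * (64 * n ^ 2) < U.card * U.card * N ^ 4 * (64 * n ^ 2) := by
      calc _ = 64 * S ^ 4 * Q * n ^ 2 := by ring
        _ < _ := hi
        _ ≤ _ := h1
        _ = _ := by ring
    exact Nat.lt_of_mul_lt_mul_right h2
  obtain ⟨u, hu, u', hu', v, hv, v', hv', hne, hrr⟩ :=
    rep_of_mem A Ξ _ _ hU hU σ hσ N S hS hΞ0 hΞN hUU r hr
  obtain ⟨y, hy0, hyX, hyC⟩ := hrich _ (hUΞ u hu)
  set X := nb A Ξ y with hX
  set Cc := (fib A (u / y₂)).filter (· ∈ X) with hCc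
  have hXne : X.Nonempty := by
    rw [← Finset.card_pos]
    by_contra h
    have : X.card = 0 := by omega
    rw [this] at hyX; omega
  have hCne : Cc.Nonempty := by
    rw [← Finset.card_pos]
    by_contra h
    have : Cc.card = 0 := by omega
    rw [this] at hyC
    have : 0 < e * N := by positivity
    omega
  have hXA : X ⊆ A := nb_subset _ _ _
  have hCX : Cc ⊆ X := fun c hc => (Finset.mem_filter.1 hc).2
  have hCf : Cc ⊆ fib A (u / y₂) := Finset.filter_subset _ _
  obtain ⟨X', hX', hX'ne, hpl⟩ := plun_two X (σ • Cc) (r • Cc) hXne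
    hCne.smul_finset hCne.smul_finset
  have hd : u / y₂ - u' / y₂ = (u - u') / y₂ := by rw [sub_div]
  have hd' : v / y₂ - v' / y₂ = (v - v') / y₂ := by rw [sub_div]
  have hvv : v - v' ≠ 0 := sub_ne_zero.2 hne
  have hscale : (X + r • Cc).card =
      ((u / y₂ - u' / y₂) • Cc + (v / y₂ - v' / y₂) • X).card := by
    apply card_add_smul_scale
    · rw [hd']; exact div_ne_zero hvv hy₂
    · rw [hd, hd', hrr]; field_simp
  have hb3 := bound_three A Cc X (hCX.trans hXA) hXA (u / y₂) (u' / y₂) (v / y₂) (v' / y₂) σ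
    (hΞ0 _ (hΞ' (hUΞ _ hu'))) (hΞ0 _ (hΞ' (hUΞ _ hv))) (hΞ0 _ (hΞ' (hUΞ _ hv'))) hσ N S hS
    (hΞN _ (hΞ' (hUΞ _ hu'))) (hΞN _ (hΞ' (hUΞ _ hv))) (hΞN _ (hΞ' (hUΞ _ hv')))
    ((Finset.smul_finset_subset_smul_finset hCf).trans (smul_fib_subset _ _))
  rw [← hscale, ← hQ] at hb3
  have hXS : (X + σ • Cc).card ≤ S := (Finset.card_le_card (Finset.add_subset_add hXA
    (Finset.smul_finset_subset_smul_finset (hCX.trans hXA)))).trans hS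
  have hsmall : (X' + (r + σ) • Cc).card < X'.card * Cc.card := by
    by_contra hge
    push Not at hge
    have h1 : X' + (r + σ) • Cc ⊆ X' + σ • Cc + r • Cc := by
      rw [add_assoc]
      apply Finset.add_subset_add_left
      intro t ht
      obtain ⟨c, hc, rfl⟩ := Finset.mem_smul_finset.1 ht
      rw [add_smul, add_comm]
      exact Finset.add_mem_add (Finset.smul_mem_smul_finset hc) (Finset.smul_mem_smul_finset hc)
    have h2 : X'.card * Cc.card * X.card ^ 2 ≤ 4 * S * (X + r • Cc).card * X'.card := by
      calc _ ≤ (X' + σ • Cc + r • Cc).card * X.card ^ 2 :=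
            Nat.mul_le_mul_right _ (hge.trans (Finset.card_le_card h1))
        _ ≤ _ := hpl
        _ ≤ _ := by gcongr
    have h3 : Cc.card * X.card ^ 2 ≤ 4 * S * (X + r • Cc).card := by
      apply Nat.le_of_mul_le_mul_right _ hX'ne.card_pos
      calc _ = X'.card * Cc.card * X.card ^ 2 := by ring
        _ ≤ _ := h2
    have h4 : Cc.card * X.card ^ 2 * N ^ 3 ≤ 4 * S ^ 4 * Q := by
      calc _ ≤ 4 * S * (X + r • Cc).card * N ^ 3 := by gcongr
        _ = 4 * S * ((X + r • Cc).card * N ^ 3) := by ring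
        _ ≤ 4 * S * (S ^ 3 * Q) := by gcongr
        _ = _ := by ring
    have h5 : e ^ 3 * N ^ 4 ≤ 512 * S ^ 4 * Q * n ^ 4 := by
      calc e ^ 3 * N ^ 4 = e ^ 2 * (e * N) * N ^ 3 := by ring
        _ ≤ (2 * n * X.card) ^ 2 * (32 * n ^ 2 * Cc.card) * N ^ 3 := by gcongr
        _ = 128 * n ^ 4 * (Cc.card * X.card ^ 2 * N ^ 3) := by ring
        _ ≤ 128 * n ^ 4 * (4 * S ^ 4 * Q) := by gcongr
        _ = _ := by ring
    omega
  obtain ⟨x, hx, x', hx', c, hc, c', hc', hcne, hrs⟩ := rep_of_small _ _ _ hsmall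
  refine ⟨x / y, (mem_nb.1 (hX' hx)).2, x' / y, (mem_nb.1 (hX' hx')).2, c / y,
    (mem_nb.1 (hCX hc)).2, c' / y, (mem_nb.1 (hCX hc')).2, ?_, ?_⟩
  · intro h
    exact hcne ((div_left_inj' hy0).1 h)
  · have : c - c' ≠ 0 := sub_ne_zero.2 hcne
    rw [hrs, ← sub_div, ← sub_div]
    field_simp

lemma core [Fintype F] (A Ξ : Finset F) (σ : F) (h0 : (0:F) ∉ A)
    (hσ : σ = 1 ∨ σ = -1) (N S n e : ℕ) (hn : A.card ≤ n) (hS : (A + σ • A).card ≤ S)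
    (hΞ0 : ∀ ξ ∈ Ξ, ξ ≠ 0) (hΞi : ∀ ξ ∈ Ξ, ξ⁻¹ ∈ Ξ)
    (hΞN : ∀ ξ ∈ Ξ, N ≤ (fib A ξ).card) (hN : 0 < N)
    (he : e = ∑ ξ ∈ Ξ, (fib A ξ).card)
    (hi : 64 * S ^ 4 * (A + σ • A + σ • A + σ • A).card * n ^ 2 < e ^ 2 * N ^ 4)
    (hii : 512 * S ^ 4 * (A + σ • A + σ • A + σ • A).card * n ^ 4 < e ^ 3 * N ^ 4) :
    ∃ (G : Subfield F) (Y : Finset F) (y₀ : F), Y ⊆ A ∧ e ≤ 2 * n * Y.card ∧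
      (∀ y ∈ Y, ∃ g ∈ G, y = y₀ * g) ∧
      ∀ r ∈ G, (Y + r • Y).card * N ^ 4 ≤
        S ^ 4 * (A + σ • A + σ • A + σ • A).card := by
  set Q := (A + σ • A + σ • A + σ • A).card with hQ
  have hA0 : ∀ y ∈ A, y ≠ 0 := fun y hy h => h0 (h ▸ hy)
  have he0 : 0 < e := by
    rcases Nat.eq_zero_or_pos e with h | h
    · rw [h] at hi; simp at hi
    · exact h
  have heA : e = ∑ y ∈ A, (nb A Ξ y).card := by
    rw [he, ← count_nb A Ξ A h0 subset_rfl]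
    apply Finset.sum_congr rfl
    intro ξ _
    congr 1
    ext z
    simp [fib]
    tauto
  have hn0 : 0 < n := by
    rcases Nat.eq_zero_or_pos n with h | h
    · have : A = ∅ := by rw [← Finset.card_eq_zero]; omega
      rw [this] at heA
      simp at heA
      omega
    · exact h
  -- popular vertices
  have hY := popular A (fun y => (nb A Ξ y).card) n 1 e hn0 hn (by rw [one_mul]; exact heA.le)
  set Y := A.filter (fun y => e ≤ 2 * 1 * n * (nb A Ξ y).card) with hYdef
  have hYA : Y ⊆ A := Finset.filter_subset _ _
  have hYd : ∀ y ∈ Y, e ≤ 2 * n * (nb A Ξ y).card := by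
    intro y hy
    have := (Finset.mem_filter.1 hy).2
    simpa using this
  -- degrees into Y
  let g : F → ℕ := fun z => (Y.filter (fun y => z ∈ nb A Ξ y)).card
  have hdc : ∀ W ⊆ A, ∑ y ∈ Y, (W.filter (· ∈ nb A Ξ y)).card = ∑ z ∈ W, g z := by
    intro W _
    exact Finset.sum_card_bipartiteAbove_eq_sum_card_bipartiteBelow (s := Y) (t := W)
      (fun y z => z ∈ nb A Ξ y)
  have hgA : ∑ y ∈ Y, (nb A Ξ y).card = ∑ z ∈ A, g z := by
    rw [← hdc A subset_rfl]
    apply Finset.sum_congr rfl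
    intro y _
    congr 1
    ext z
    simp [nb]
  rw [hgA] at hY
  have hZ := popular A g n 2 e hn0 hn (by simpa using hY)
  set Z := A.filter (fun z => e ≤ 2 * 2 * n * g z) with hZdef
  have hZA : Z ⊆ A := Finset.filter_subset _ _
  have hZd : ∀ z ∈ Z, e ≤ 4 * n * g z := by
    intro z hz
    exact (Finset.mem_filter.1 hz).2
  have hgnb : ∀ z ∈ A, g z ≤ (nb A Ξ z).card := by
    intro z _
    apply Finset.card_le_card
    intro y hy
    rw [Finset.mem_filter, mem_nb] at hy
    rw [mem_nb]
    refine ⟨hYA hy.1, ?_⟩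
    have := hΞi _ hy.2.2
    rwa [inv_div] at this
  have hZ2 : e ≤ 4 * ∑ ξ ∈ Ξ, ((fib A ξ).filter (· ∈ Z)).card := by
    rw [count_nb A Ξ Z h0 hZA]
    calc e ≤ _ := hZ
      _ ≤ 4 * ∑ y ∈ Z, (nb A Ξ y).card := by
        apply Nat.mul_le_mul (by norm_num)
        exact Finset.sum_le_sum (fun z hz => hgnb z (hZA hz))
  -- popular slopes
  set Ξ' := Ξ.filter (fun ξ => N ≤ 8 * ((fib A ξ).filter (· ∈ Z)).card) with hΞ'def
  have hΞ'Ξ : Ξ' ⊆ Ξ := Finset.filter_subset _ _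
  have hMN : N * Ξ.card ≤ e := by
    rw [he, mul_comm, ← smul_eq_mul]
    exact Finset.card_nsmul_le_sum _ _ _ hΞN
  have hΞ's : e ≤ 8 * ∑ y ∈ A, (nb A Ξ' y).card := by
    have h1 := Finset.sum_filter_add_sum_filter_not Ξ
      (fun ξ => N ≤ 8 * ((fib A ξ).filter (· ∈ Z)).card)
      (fun ξ => ((fib A ξ).filter (· ∈ Z)).card)
    have h2 : 8 * ∑ ξ ∈ Ξ.filter (fun ξ => ¬ N ≤ 8 * ((fib A ξ).filter (· ∈ Z)).card),
        ((fib A ξ).filter (· ∈ Z)).card ≤ e := by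
      rw [Finset.mul_sum]
      calc _ ≤ ∑ ξ ∈ Ξ.filter (fun ξ => ¬ N ≤ 8 * ((fib A ξ).filter (· ∈ Z)).card), N := by
            apply Finset.sum_le_sum
            intro ξ hξ
            have := (Finset.mem_filter.1 hξ).2
            omega
        _ = (Ξ.filter (fun ξ => ¬ N ≤ 8 * ((fib A ξ).filter (· ∈ Z)).card)).card * N := by
            rw [Finset.sum_const, smul_eq_mul]
        _ ≤ Ξ.card * N := Nat.mul_le_mul_right _ (Finset.card_filter_le _ _)
        _ ≤ e := by rw [mul_comm]; exact hMN
    have h3 : ∑ ξ ∈ Ξ', ((fib A ξ).filter (· ∈ Z)).card ≤ ∑ y ∈ A, (nb A Ξ' y).card := by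
      rw [← count_nb A Ξ' A h0 subset_rfl]
      apply Finset.sum_le_sum
      intro ξ _
      apply Finset.card_le_card
      intro z hz
      rw [Finset.mem_filter] at hz ⊢
      exact ⟨hz.1, hZA hz.2⟩
    rw [← hΞ'def] at h1
    omega
  have hexU : ∃ y₂ ∈ A, e ≤ 8 * n * (nb A Ξ' y₂).card := by
    by_contra hcon
    push Not at hcon
    have hAne : A.Nonempty := by
      rw [Finset.nonempty_iff_ne_empty]
      rintro rfl
      simp at hΞ's
      omega
    have h1 : ∑ y ∈ A, 8 * n * (nb A Ξ' y).card < ∑ y ∈ A, e :=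
      Finset.sum_lt_sum_of_nonempty hAne hcon
    rw [← Finset.mul_sum, Finset.sum_const, smul_eq_mul] at h1
    have h2 : A.card * e ≤ n * e := Nat.mul_le_mul_right _ hn
    have h3 : n * e ≤ n * (8 * ∑ y ∈ A, (nb A Ξ' y).card) := Nat.mul_le_mul_left _ hΞ's
    have h4 : n * (8 * ∑ y ∈ A, (nb A Ξ' y).card) = 8 * n * ∑ y ∈ A, (nb A Ξ' y).card := by ring
    omega
  obtain ⟨y₂, hy₂, hU⟩ := hexU
  have hrich : ∀ ξ ∈ Ξ', ∃ y : F, y ≠ 0 ∧ e ≤ 2 * n * (nb A Ξ y).card ∧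
      e * N ≤ 32 * n ^ 2 * ((fib A ξ).filter (· ∈ nb A Ξ y)).card := by
    intro ξ hξ
    have hξN := (Finset.mem_filter.1 hξ).2
    by_contra hcon
    push Not at hcon
    have hcon' : ∀ y ∈ Y, 32 * n ^ 2 * ((fib A ξ).filter (· ∈ nb A Ξ y)).card < e * N :=
      fun y hy => hcon y (hA0 _ (hYA hy)) (hYd y hy)
    have h1 := hdc (fib A ξ) (Finset.filter_subset _ _)
    have h2 : ((fib A ξ).filter (· ∈ Z)).card * e ≤ 4 * n * ∑ z ∈ fib A ξ, g z := by
      calc _ = ∑ z ∈ (fib A ξ).filter (· ∈ Z), e := by rw [Finset.sum_const, smul_eq_mul]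
        _ ≤ ∑ z ∈ (fib A ξ).filter (· ∈ Z), 4 * n * g z :=
            Finset.sum_le_sum (fun z hz => hZd z (Finset.mem_filter.1 hz).2)
        _ = 4 * n * ∑ z ∈ (fib A ξ).filter (· ∈ Z), g z := by rw [Finset.mul_sum]
        _ ≤ _ := Nat.mul_le_mul_left _ (Finset.sum_le_sum_of_subset (Finset.filter_subset _ _))
    have h3 : e * N ≤ 32 * n * ∑ z ∈ fib A ξ, g z := by
      calc e * N ≤ e * (8 * ((fib A ξ).filter (· ∈ Z)).card) := by gcongr
        _ = 8 * (((fib A ξ).filter (· ∈ Z)).card * e) := by ring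
        _ ≤ 8 * (4 * n * ∑ z ∈ fib A ξ, g z) := by gcongr
        _ = _ := by ring
    have hYne : Y.Nonempty := by
      rw [Finset.nonempty_iff_ne_empty]
      intro hYe
      rw [hYe] at h1
      simp only [Finset.sum_empty] at h1
      rw [← h1] at h3
      have : 0 < e * N := by positivity
      omega
    have h4 := Finset.sum_lt_sum_of_nonempty hYne hcon'
    rw [← Finset.mul_sum, h1, Finset.sum_const, smul_eq_mul] at h4
    have h5 : Y.card * (e * N) ≤ n * (e * N) :=
      Nat.mul_le_mul_right _ ((Finset.card_le_card hYA).trans hn)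
    have h6 : n * (e * N) ≤ n * (32 * n * ∑ z ∈ fib A ξ, g z) := Nat.mul_le_mul_left _ h3
    have h7 : n * (32 * n * ∑ z ∈ fib A ξ, g z) = 32 * n ^ 2 * ∑ z ∈ fib A ξ, g z := by ring
    omega
  -- closure
  have hadd : ∀ r ∈ quotSet Ξ, r + σ ∈ quotSet Ξ := by
    intro r hr
    exact add_closed A Ξ Ξ' (nb A Ξ' y₂) σ hσ N S n e hS hΞ0 hΞN hN he0 hΞ'Ξ (nb_subset _ _ _)
      y₂ (hA0 _ hy₂) (fun u hu => (mem_nb.1 hu).2) hU hi hii hrich r hr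
  have hmul : ∀ y ∈ Y, ∀ y' ∈ Y, ∀ r ∈ quotSet Ξ, (y' / y) * r ∈ quotSet Ξ := by
    intro y hy y' hy' r hr
    refine mul_closed A Ξ σ hσ N S hS hΞ0 hΞN y y' (hA0 _ (hYA hy)) (hA0 _ (hYA hy')) ?_ r hr
    have h1 : e ^ 2 * N ^ 4 ≤ (2 * n * (nb A Ξ y).card) * (2 * n * (nb A Ξ y').card) * N ^ 4 := by
      rw [pow_two]
      gcongr
      · exact hYd y hy
      · exact hYd y' hy'
    have h2 : S ^ 4 * Q * (4 * n ^ 2) <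
        (nb A Ξ y).card * (nb A Ξ y').card * N ^ 4 * (4 * n ^ 2) := by
      calc S ^ 4 * Q * (4 * n ^ 2) ≤ 64 * S ^ 4 * Q * n ^ 2 := by
            have : 64 * S ^ 4 * Q * n ^ 2 = 16 * (S ^ 4 * Q * (4 * n ^ 2)) := by ring
            omega
        _ < _ := hi
        _ ≤ _ := h1
        _ = _ := by ring
    exact Nat.lt_of_mul_lt_mul_right h2
  have hYne : Y.Nonempty := by
    rw [Finset.nonempty_iff_ne_empty]
    intro hYe
    have h1 : ∑ z ∈ A, g z = 0 := by
      rw [← hgA, hYe]; simp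
    rw [h1] at hY
    omega
  obtain ⟨y₀, hy₀⟩ := hYne
  have hy₀0 : y₀ ≠ 0 := hA0 _ (hYA hy₀)
  have hzero : (0:F) ∈ quotSet Ξ := by
    -- two distinct slopes exist
    by_contra hcon
    have hone : Ξ.card ≤ 1 := by
      rw [Finset.card_le_one]
      intro a ha b hb
      by_contra hab
      exact hcon ⟨a, ha, a, ha, a, ha, b, hb, hab, by simp⟩
    -- then sums are too small
    have hle : e ≤ n := by
      calc e = ∑ ξ ∈ Ξ, (fib A ξ).card := he
        _ ≤ ∑ ξ ∈ Ξ, n := Finset.sum_le_sum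
            (fun ξ _ => (Finset.card_filter_le _ _).trans hn)
        _ = Ξ.card * n := by rw [Finset.sum_const, smul_eq_mul]
        _ ≤ 1 * n := Nat.mul_le_mul_right _ hone
        _ = n := one_mul n
    have hNA : N ≤ A.card := by
      have : Ξ.Nonempty := by
        rw [Finset.nonempty_iff_ne_empty]
        rintro rfl
        simp at he; omega
      obtain ⟨ξ, hξ⟩ := this
      exact (hΞN ξ hξ).trans (Finset.card_filter_le _ _)
    have hAS : A.card ≤ S := by
      refine le_trans ?_ hS
      have hne : (σ • A).Nonempty := Finset.Nonempty.smul_finset ⟨y₀, hYA hy₀⟩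
      exact Finset.card_le_card_add_right hne
    have hQ0 : 0 < Q := by
      rw [hQ, Finset.card_pos]
      have hAne : A.Nonempty := ⟨y₀, hYA hy₀⟩
      have hne : (σ • A).Nonempty := hAne.smul_finset
      exact ((hAne.add hne).add hne).add hne
    have : e ^ 2 * N ^ 4 ≤ 64 * S ^ 4 * Q * n ^ 2 := by
      have hNS : N ≤ S := hNA.trans hAS
      calc e ^ 2 * N ^ 4 ≤ n ^ 2 * S ^ 4 := by gcongr
        _ = 1 * S ^ 4 * 1 * n ^ 2 := by ring
        _ ≤ 64 * S ^ 4 * Q * n ^ 2 := by gcongr <;> omega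
    omega
  obtain ⟨G, hGR, hGM⟩ := exists_subfield (quotSet Ξ) hzero (quot_neg Ξ) σ hσ hadd
    {m | ∃ y ∈ Y, m = y / y₀}
    (by
      rintro m ⟨y, hy, rfl⟩
      exact div_ne_zero (hA0 _ (hYA hy)) hy₀0)
    (by
      rintro m ⟨y, hy, rfl⟩ r hr
      exact hmul _ hy₀ _ hy r hr)
    (by
      rintro m ⟨y, hy, rfl⟩ r hr
      rw [inv_div]
      exact hmul _ hy _ hy₀ r hr)
  refine ⟨G, Y, y₀, hYA, ?_, ?_, ?_⟩
  · have h1 : ∑ z ∈ A, g z ≤ Y.card * n := by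
      rw [← hgA, ← smul_eq_mul]
      exact Finset.sum_le_card_nsmul _ _ _
        (fun y _ => (Finset.card_le_card (nb_subset _ _ _)).trans hn)
    calc e ≤ 2 * 1 * ∑ z ∈ A, g z := hY
      _ ≤ 2 * 1 * (Y.card * n) := by gcongr
      _ = _ := by ring
  · intro y hy
    refine ⟨y / y₀, hGM _ ⟨y, hy, rfl⟩, ?_⟩
    rw [mul_div_cancel₀ _ hy₀0]
  · intro r hr
    obtain ⟨x1, h1, x2, h2, x3, h3, x4, h4, hne, hr'⟩ := hGR r hr
    rw [card_add_smul_scale Y Y r (x1 - x2) (x3 - x4) (sub_ne_zero.2 hne) hr']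
    exact bound_four A Y Y hYA hYA x1 x2 x3 x4 σ (hΞ0 _ h1) (hΞ0 _ h2) (hΞ0 _ h3) (hΞ0 _ h4) hσ N S
      hS (hΞN _ h1) (hΞN _ h2) (hΞN _ h3) (hΞN _ h4)


/-! ### Energy -/

/-- points of `U` moved into `V` by `ξ`. -/
def fb (U V : Finset F) (ξ : F) : Finset F := U.filter fun a => ξ * a ∈ V

lemma mem_fb {U V : Finset F} {ξ a : F} : a ∈ fb U V ξ ↔ a ∈ U ∧ ξ * a ∈ V := by
  simp [fb]

lemma quad_count [Fintype F] (X Y Z W : Finset F) (hZ : (0:F) ∉ Z) :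
    (((X ×ˢ Z) ×ˢ (Y ×ˢ W)).filter fun t => t.1.1 * t.2.1 = t.1.2 * t.2.2).card =
      ∑ ξ : F, (fb Z X ξ).card * (fb Y W ξ).card := by
  rw [Finset.card_eq_sum_card_fiberwise (t := Finset.univ) (f := fun t => t.1.1 / t.1.2)
    (fun _ _ => Finset.mem_coe.2 (Finset.mem_univ _))]
  refine Finset.sum_congr rfl fun ξ _ => ?_
  rw [← Finset.card_product]
  refine Finset.card_bij' (fun t _ => (t.1.2, t.2.1))
    (fun p _ => ((ξ * p.1, p.1), (p.2, ξ * p.2))) ?_ ?_ ?_ ?_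
  · rintro ⟨⟨a, c⟩, ⟨b, d⟩⟩ h
    simp only [Finset.mem_filter, Finset.mem_product] at h
    obtain ⟨⟨⟨⟨ha, hc⟩, hb, hd⟩, h1⟩, h2⟩ := h
    have hc0 : c ≠ 0 := fun h => hZ (h ▸ hc)
    subst h2
    simp only [Finset.mem_product, mem_fb]
    refine ⟨⟨hc, ?_⟩, hb, ?_⟩
    · rwa [div_mul_cancel₀ _ hc0]
    · have : a / c * b = d := by
        field_simp
        linear_combination h1
      rwa [this]
  · rintro ⟨c, b⟩ h
    simp only [Finset.mem_product, mem_fb] at h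
    obtain ⟨⟨hc, h1⟩, hb, h2⟩ := h
    have hc0 : c ≠ 0 := fun h => hZ (h ▸ hc)
    simp only [Finset.mem_filter, Finset.mem_product]
    refine ⟨⟨⟨⟨h1, hc⟩, hb, h2⟩, by ring⟩, ?_⟩
    field_simp
  · rintro ⟨⟨a, c⟩, ⟨b, d⟩⟩ h
    simp only [Finset.mem_filter, Finset.mem_product] at h
    obtain ⟨⟨⟨⟨ha, hc⟩, hb, hd⟩, h1⟩, h2⟩ := h
    have hc0 : c ≠ 0 := fun h => hZ (h ▸ hc)
    subst h2
    simp only [Prod.mk.injEq, true_and, and_true]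
    refine ⟨by field_simp, ?_⟩
    field_simp
    linear_combination h1
  · rintro ⟨c, b⟩ h
    rfl

lemma energy_eq [Fintype F] (A : Finset F) (h0 : (0:F) ∉ A) :
    mulEnergy A = ∑ ξ : F, (fib A ξ).card ^ 2 := by
  rw [mulEnergy, quad_count A A A A h0]
  refine Finset.sum_congr rfl fun ξ _ => ?_
  rw [sq]; rfl

lemma cross_eq [Fintype F] (X Y : Finset F) (hX : (0:F) ∉ X) (hY : (0:F) ∉ Y) :
    ∑ ξ : F, (fb X Y ξ).card ^ 2 = ∑ ξ : F, (fib X ξ).card * (fib Y ξ).card := by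
  have h1 := quad_count Y X X Y hX
  have h2 := quad_count X Y X Y hX
  simp only [sq]
  change _ = ∑ ξ : F, (fb X X ξ).card * (fb Y Y ξ).card
  rw [← h1, ← h2]
  refine Finset.card_bij' (fun t _ => ((t.2.1, t.1.2), (t.1.1, t.2.2)))
    (fun t _ => ((t.2.1, t.1.2), (t.1.1, t.2.2))) ?_ ?_ ?_ ?_
  · rintro ⟨⟨a, c⟩, ⟨b, d⟩⟩ h
    simp only [Finset.mem_filter, Finset.mem_product] at h ⊢
    exact ⟨⟨⟨h.1.2.1, h.1.1.2⟩, h.1.1.1, h.1.2.2⟩, by rw [← h.2]; ring⟩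
  · rintro ⟨⟨a, c⟩, ⟨b, d⟩⟩ h
    simp only [Finset.mem_filter, Finset.mem_product] at h ⊢
    exact ⟨⟨⟨h.1.2.1, h.1.1.2⟩, h.1.1.1, h.1.2.2⟩, by rw [← h.2]; ring⟩
  · rintro ⟨⟨a, c⟩, ⟨b, d⟩⟩ h
    rfl
  · rintro ⟨⟨a, c⟩, ⟨b, d⟩⟩ h
    rfl

lemma cross_le [Fintype F] (X Y : Finset F) (hX : (0:F) ∉ X) (hY : (0:F) ∉ Y) :
    2 * ∑ ξ : F, (fb X Y ξ).card ^ 2 ≤ mulEnergy X + mulEnergy Y := by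
  rw [cross_eq X Y hX hY, energy_eq X hX, energy_eq Y hY, Finset.mul_sum,
    ← Finset.sum_add_distrib]
  refine Finset.sum_le_sum fun ξ _ => ?_
  rw [← mul_assoc]
  exact two_mul_le_add_sq _ _

lemma energy_union [Fintype F] (X Y : Finset F) (hX : (0:F) ∉ X) (hY : (0:F) ∉ Y) :
    mulEnergy (X ∪ Y) ≤ 8 * mulEnergy X + 8 * mulEnergy Y := by
  have hXY : (0:F) ∉ X ∪ Y := by simp [hX, hY]
  have h1 := cross_le X Y hX hY
  have h2 := cross_le Y X hY hX
  have h3 : mulEnergy (X ∪ Y) ≤ ∑ ξ : F, (4 * (fib X ξ).card ^ 2 + 4 * (fib Y ξ).card ^ 2 +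
      4 * (fb X Y ξ).card ^ 2 + 4 * (fb Y X ξ).card ^ 2) := by
    rw [energy_eq _ hXY]
    refine Finset.sum_le_sum fun ξ _ => ?_
    have hs : fib (X ∪ Y) ξ ⊆ fib X ξ ∪ fib Y ξ ∪ fb X Y ξ ∪ fb Y X ξ := by
      intro a
      simp only [fib, fb, Finset.mem_filter, Finset.mem_union]
      tauto
    have hc : (fib (X ∪ Y) ξ).card ≤ (fib X ξ).card + (fib Y ξ).card + (fb X Y ξ).card +
        (fb Y X ξ).card := by
      refine (Finset.card_le_card hs).trans ?_
      refine (Finset.card_union_le _ _).trans (Nat.add_le_add_right ?_ _)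
      refine (Finset.card_union_le _ _).trans (Nat.add_le_add_right ?_ _)
      exact Finset.card_union_le _ _
    generalize (fib X ξ).card = a at *
    generalize (fib Y ξ).card = b at *
    generalize (fb X Y ξ).card = c at *
    generalize (fb Y X ξ).card = d at *
    calc _ ≤ (a + b + c + d) ^ 2 := Nat.pow_le_pow_left hc 2
      _ ≤ _ := by
        zify
        nlinarith [sq_nonneg ((a:ℤ) - b), sq_nonneg ((a:ℤ) - c), sq_nonneg ((a:ℤ) - d),
          sq_nonneg ((b:ℤ) - c), sq_nonneg ((b:ℤ) - d), sq_nonneg ((c:ℤ) - d)]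
  simp only [Finset.sum_add_distrib, ← Finset.mul_sum] at h3
  rw [← energy_eq X hX, ← energy_eq Y hY] at h3
  omega

lemma fib_inv (A : Finset F) (ξ : F) (hξ : ξ ≠ 0) : (fib A ξ⁻¹).card = (fib A ξ).card := by
  refine Finset.card_bij' (fun a _ => ξ⁻¹ * a) (fun a _ => ξ * a) ?_ ?_ ?_ ?_
  · intro a ha
    simp only [fib, Finset.mem_filter] at ha ⊢
    exact ⟨ha.2, by rw [mul_inv_cancel_left₀ hξ]; exact ha.1⟩
  · intro a ha
    simp only [fib, Finset.mem_filter] at ha ⊢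
    exact ⟨ha.2, by rw [inv_mul_cancel_left₀ hξ]; exact ha.1⟩
  · intro a _
    exact mul_inv_cancel_left₀ hξ a
  · intro a _
    exact inv_mul_cancel_left₀ hξ a

lemma fib_zero (A : Finset F) (h0 : (0:F) ∉ A) : fib A 0 = ∅ := by
  simp [fib, h0]

/-- Logarithmic pigeonholing. -/
lemma layer {ι : Type*} [Fintype ι] (f : ι → ℕ) (n : ℕ) (hn : 0 < n) (hf : ∀ i, f i ≤ n) :
    ∃ N : ℕ, 0 < N ∧ ((∑ i, f i ^ 2 : ℕ) : ℝ) ≤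
      (1 + Real.log n) * (((∑ i ∈ Finset.univ.filter (fun i => N ≤ f i), f i : ℕ) : ℝ) * N) := by
  set E : ℝ := ((∑ i, f i ^ 2 : ℕ) : ℝ) with hE
  set e : ℕ → ℝ := fun N => ((∑ i ∈ Finset.univ.filter (fun i => N ≤ f i), f i : ℕ) : ℝ) with he
  have hsum : E = ∑ k ∈ Finset.Icc 1 n, e k := by
    rw [hE, he]
    simp only []
    rw [← Nat.cast_sum]
    congr 1
    simp only [Finset.sum_filter]
    rw [Finset.sum_comm]
    refine Finset.sum_congr rfl fun i _ => ?_
    rw [← Finset.sum_filter, Finset.sum_const, smul_eq_mul, sq]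
    congr 1
    have : (Finset.Icc 1 n).filter (fun k => k ≤ f i) = Finset.Icc 1 (f i) := by
      ext k
      have := hf i
      simp only [Finset.mem_filter, Finset.mem_Icc]
      omega
    rw [this]; simp
  by_contra hcon
  push Not at hcon
  set L : ℝ := 1 + Real.log n with hL
  have hL1 : 1 ≤ L := by
    have : 0 ≤ Real.log n := Real.log_natCast_nonneg n
    linarith
  have hH : (∑ k ∈ Finset.Icc 1 n, ((k:ℝ))⁻¹) ≤ L := by
    have := harmonic_le_one_add_log n
    rw [harmonic_eq_sum_Icc] at this
    push_cast at this
    exact this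
  have hlt : ∑ k ∈ Finset.Icc 1 n, e k < ∑ k ∈ Finset.Icc 1 n, E / L * ((k:ℝ))⁻¹ := by
    apply Finset.sum_lt_sum_of_nonempty
    · exact ⟨1, Finset.mem_Icc.2 ⟨le_rfl, hn⟩⟩
    · intro k hk
      have hk0 : 0 < k := (Finset.mem_Icc.1 hk).1
      have h := hcon k hk0
      have hk1 : (0:ℝ) < k := by exact_mod_cast hk0
      rw [← div_eq_mul_inv, div_div, lt_div_iff₀ (by positivity)]
      calc e k * (L * k) = L * (e k * k) := by ring
        _ < E := h
  rw [← hsum, ← Finset.mul_sum] at hlt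
  have hE0 : 0 ≤ E := by positivity
  have : E / L * ∑ k ∈ Finset.Icc 1 n, ((k:ℝ))⁻¹ ≤ E / L * L := by gcongr
  rw [div_mul_cancel₀ _ (by positivity)] at this
  linarith

/-! ### Expansion for a random dilate -/

lemma expand (Y G : Finset F) (hY : 0 < Y.card) (hG : G.Nonempty) :
    ∃ r ∈ G, Y.card ^ 2 * G.card ≤ (Y + r • Y).card * (G.card + Y.card ^ 2) := by
  set m := Y.card with hm
  let P := Y ×ˢ Y
  have hP : P.card = m ^ 2 := by simp [P, Finset.card_product, sq, hm]
  let K : F → ℕ := fun r =>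
    ((P ×ˢ P).filter fun t => t.1.1 + r * t.1.2 = t.2.1 + r * t.2.2).card
  have hCS : ∀ r, m ^ 4 ≤ (Y + r • Y).card * K r := by
    intro r
    have hmap : ∀ p ∈ P, p.1 + r * p.2 ∈ Y + r • Y := by
      intro p hp
      obtain ⟨h1, h2⟩ := Finset.mem_product.1 hp
      exact Finset.add_mem_add h1 (Finset.smul_mem_smul_finset h2)
    have h1 := Finset.card_eq_sum_card_fiberwise (s := P) (t := Y + r • Y)
      (f := fun p => p.1 + r * p.2) (fun p hp => hmap p hp)
    have h2 := sq_sum_le_card_mul_sum_sq (s := Y + r • Y)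
      (f := fun z => ((P.filter fun p => p.1 + r * p.2 = z).card : ℕ))
    rw [← h1, hP] at h2
    have h3 : K r = ∑ z ∈ Y + r • Y, (P.filter fun p => p.1 + r * p.2 = z).card ^ 2 := by
      simp only [K]
      rw [Finset.card_eq_sum_card_fiberwise (t := Y + r • Y)
        (f := fun t => t.1.1 + r * t.1.2)]
      · refine Finset.sum_congr rfl fun z _ => ?_
        rw [sq, ← Finset.card_product]
        congr 1
        ext ⟨p, p'⟩
        simp only [Finset.mem_filter, Finset.mem_product]
        constructor
        · rintro ⟨⟨⟨a, b⟩, c⟩, d⟩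
          exact ⟨⟨a, d⟩, b, by rw [← c, d]⟩
        · rintro ⟨⟨a, d⟩, b, c⟩
          exact ⟨⟨⟨a, b⟩, by rw [c, d]⟩, d⟩
      · intro t ht
        have ht := Finset.mem_coe.1 ht
        exact hmap _ (Finset.mem_product.1 (Finset.mem_filter.1 ht).1).1
    rw [h3]
    calc m ^ 4 = (m ^ 2) ^ 2 := by ring
      _ ≤ _ := h2
  have hsum : ∑ r ∈ G, K r ≤ G.card * m ^ 2 + m ^ 4 := by
    simp only [K, Finset.card_filter]
    rw [Finset.sum_comm]
    simp only [← Finset.card_filter]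
    calc _ ≤ ∑ t ∈ P ×ˢ P, ((if t.1 = t.2 then G.card else 0) + 1) := by
          refine Finset.sum_le_sum ?_
          rintro ⟨⟨a, b⟩, ⟨c, d⟩⟩ _
          by_cases h : ((a, b) : F × F) = (c, d)
          · simp only [h, if_true]
            exact (Finset.card_filter_le _ _).trans (Nat.le_succ _)
          · simp only [h, if_false, zero_add]
            rw [Finset.card_le_one]
            intro r hr r' hr'
            have e1 := (Finset.mem_filter.1 hr).2
            have e2 := (Finset.mem_filter.1 hr').2
            have hbd : b - d ≠ 0 := by
              intro hbd
              have hbd : b = d := sub_eq_zero.1 hbd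
              subst hbd
              exact h (by rw [add_right_cancel e1])
            apply mul_right_cancel₀ hbd
            linear_combination e1 - e2
      _ = _ := by
          rw [Finset.sum_add_distrib, ← Finset.sum_filter]
          simp only [Finset.sum_const, smul_eq_mul, mul_one, Finset.card_product, hP]
          have : ((P ×ˢ P).filter fun t => t.1 = t.2).card = P.card := by
            refine Finset.card_bij' (fun t _ => t.1) (fun p _ => (p, p)) ?_ ?_ ?_ ?_
            · intro t ht
              exact (Finset.mem_product.1 (Finset.mem_filter.1 ht).1).1
            · intro p hp
              exact Finset.mem_filter.2 ⟨Finset.mem_product.2 ⟨hp, hp⟩, rfl⟩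
            · intro t ht
              exact Prod.ext rfl (Finset.mem_filter.1 ht).2
            · intro p _
              rfl
          rw [this, hP]
          ring
  have hsum' : ∑ r ∈ G, K r * G.card ≤ ∑ r ∈ G, (G.card * m ^ 2 + m ^ 4) := by
    rw [← Finset.sum_mul, Finset.sum_const, smul_eq_mul, mul_comm]
    exact Nat.mul_le_mul_left _ hsum
  obtain ⟨r, hr, hle⟩ := Finset.exists_le_of_sum_le hG hsum'
  refine ⟨r, hr, ?_⟩
  have hm2 : 0 < m ^ 2 := by positivity
  apply Nat.le_of_mul_le_mul_right _ hm2
  calc m ^ 2 * G.card * m ^ 2 = m ^ 4 * G.card := by ring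
    _ ≤ (Y + r • Y).card * K r * G.card := Nat.mul_le_mul_right _ (hCS r)
    _ = (Y + r • Y).card * (K r * G.card) := by ring
    _ ≤ (Y + r • Y).card * (G.card * m ^ 2 + m ^ 4) := Nat.mul_le_mul_left _ hle
    _ = _ := by ring

/-! ### Main proposition -/

lemma root_four (x y K : ℝ) (hy : 0 ≤ y) (hK : 1 ≤ K) (h : x ^ 4 ≤ K * y ^ 4) :
    x ≤ K * y := by
  by_contra hlt
  push Not at hlt
  have h0 : 0 ≤ K * y := by positivity
  have h1 : (K * y) ^ 4 < x ^ 4 := pow_lt_pow_left₀ hlt h0 (by norm_num)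
  have h2 : K ≤ K ^ 4 := le_self_pow₀ hK (by norm_num)
  have h3 : K * y ^ 4 ≤ K ^ 4 * y ^ 4 := by gcongr
  rw [mul_pow] at h1
  linarith

lemma pow_four (s a b : ℝ) (hs : 0 ≤ s) (hab : a * 4 = b) : (s ^ a) ^ 4 = s ^ b := by
  rw [← Real.rpow_natCast, ← Real.rpow_mul hs, ← hab]
  norm_num

lemma pow_four_nat (s a : ℝ) (b : ℕ) (hs : 0 ≤ s) (hab : a * 4 = b) : (s ^ a) ^ 4 = s ^ b := by
  rw [pow_four s a b hs hab, Real.rpow_natCast]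

lemma e_le [Fintype F] (A Ξ : Finset F) (h0 : (0:F) ∉ A) :
    ∑ ξ ∈ Ξ, (fib A ξ).card ≤ A.card ^ 2 := by
  have h := count_nb A Ξ A h0 (Finset.Subset.refl _)
  have h1 : ∑ ξ ∈ Ξ, (fib A ξ).card = ∑ ξ ∈ Ξ, ((fib A ξ).filter (· ∈ A)).card := by
    refine Finset.sum_congr rfl fun ξ _ => ?_
    rw [Finset.filter_true_of_mem]
    intro x hx
    exact (Finset.mem_filter.1 hx).1
  rw [h1, h, sq, ← smul_eq_mul]
  exact Finset.sum_le_card_nsmul _ _ _ fun y _ => Finset.card_le_card (nb_subset A Ξ y)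

/-- The case of small `Y`. -/
lemma small_case (e N n m T S Q κ : ℝ) (he : 0 ≤ e) (hn : 0 < n)
    (hm0 : 0 ≤ m) (hS : 0 ≤ S) (hκ : 1 ≤ κ) (hen : e ≤ n ^ 2)
    (hem : e ≤ 2 * n * m) (hm : m ^ 2 ≤ κ * T) (hT : T * N ^ 4 ≤ S ^ 4 * Q)
    (hQ : Q * n ^ 2 ≤ 4096 * S ^ 3) :
    (e * N) ^ 4 ≤ (16384 * κ) * (S ^ 7 * n ^ 4) := by
  have h1 : e ^ 2 ≤ (2 * n * m) ^ 2 := pow_le_pow_left₀ he hem 2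
  have h2 : e ^ 2 ≤ (n ^ 2) ^ 2 := pow_le_pow_left₀ he hen 2
  calc (e * N) ^ 4 = e ^ 2 * e ^ 2 * N ^ 4 := by ring
    _ ≤ (n ^ 2) ^ 2 * (2 * n * m) ^ 2 * N ^ 4 := by gcongr
    _ = 4 * n ^ 6 * (m ^ 2 * N ^ 4) := by ring
    _ ≤ 4 * n ^ 6 * (κ * T * N ^ 4) := by gcongr
    _ = 4 * n ^ 6 * κ * (T * N ^ 4) := by ring
    _ ≤ 4 * n ^ 6 * κ * (S ^ 4 * Q) := by gcongr
    _ = 4 * n ^ 4 * κ * S ^ 4 * (Q * n ^ 2) := by ring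
    _ ≤ 4 * n ^ 4 * κ * S ^ 4 * (4096 * S ^ 3) := by gcongr
    _ = _ := by ring

/-- The case of large `Y`. -/
lemma large_case (e N n T S Q q : ℝ) (he : 0 ≤ e) (hN : 0 ≤ N)
    (hS : 0 ≤ S) (hq : 0 ≤ q) (hen : e ≤ n ^ 2)
    (hqT : q ≤ 2 * T) (hT : T * N ^ 4 ≤ S ^ 4 * Q)
    (hQ : Q * n ^ 2 ≤ 4096 * S ^ 3) :
    (e * N) ^ 4 * q ≤ 8192 * (S ^ 7 * n ^ 6) := by
  have h1 : e ^ 4 ≤ (n ^ 2) ^ 4 := pow_le_pow_left₀ he hen 4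
  have h2 : n ^ 6 = (n ^ 3) ^ 2 := by ring
  have h3 : 0 ≤ n ^ 6 := by rw [h2]; positivity
  calc (e * N) ^ 4 * q = e ^ 4 * (N ^ 4 * q) := by ring
    _ ≤ (n ^ 2) ^ 4 * (N ^ 4 * q) := mul_le_mul_of_nonneg_right h1 (by positivity)
    _ ≤ (n ^ 2) ^ 4 * (N ^ 4 * (2 * T)) := by gcongr
    _ = 2 * (n ^ 2) ^ 4 * (T * N ^ 4) := by ring
    _ ≤ 2 * (n ^ 2) ^ 4 * (S ^ 4 * Q) := by gcongr
    _ = 2 * n ^ 6 * S ^ 4 * (Q * n ^ 2) := by ring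
    _ ≤ 2 * n ^ 6 * S ^ 4 * (4096 * S ^ 3) := by gcongr
    _ = _ := by ring

set_option maxHeartbeats 1000000 in
lemma main_prop [Fintype F] (A : Finset F) (σ : F) (h0 : (0:F) ∉ A)
    (hσ : σ = 1 ∨ σ = -1) (S n : ℕ) (hn0 : 0 < n) (hn : A.card ≤ n)
    (hS : (A + σ • A).card ≤ S)
    (hQ : (A + σ • A + σ • A + σ • A).card * n ^ 2 ≤ 4096 * S ^ 3)
    (C D : ℝ) (hC : 0 < C)
    (hsub : ∀ G : Subfield F, G ≠ ⊤ → ∀ c : F,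
      ((A.filter fun x => ∃ g ∈ G, x = c * g).card : ℝ) ≤
        C * max ((Nat.card G : ℝ) ^ ((1:ℝ)/2)) D) :
    (mulEnergy A : ℝ) ≤ (1 + Real.log n) * ((2097152 * (1 + C ^ 2) + 2 * C) *
      max (max ((S:ℝ) ^ ((7:ℝ)/4) * n) ((n:ℝ) ^ 2 * D))
        ((S:ℝ) ^ ((7:ℝ)/4) * (n:ℝ) ^ ((3:ℝ)/2) * (Fintype.card F : ℝ) ^ (-(1:ℝ)/4))) := by
  have hfn : ∀ ξ, (fib A ξ).card ≤ n := fun ξ => (Finset.card_filter_le _ _).trans hn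
  obtain ⟨N, hN, hE⟩ := layer (fun ξ : F => (fib A ξ).card) n hn0 hfn
  rw [← energy_eq A h0] at hE
  set Ξ : Finset F := Finset.univ.filter (fun ξ => N ≤ (fib A ξ).card) with hΞ
  set e : ℕ := ∑ ξ ∈ Ξ, (fib A ξ).card with he
  set Q := (A + σ • A + σ • A + σ • A).card with hQdef
  set q := Fintype.card F with hq
  have hL : 0 ≤ 1 + Real.log n := by
    have : 0 ≤ Real.log n := Real.log_natCast_nonneg n
    linarith
  refine hE.trans (mul_le_mul_of_nonneg_left ?_ hL)
  have hΞN : ∀ ξ ∈ Ξ, N ≤ (fib A ξ).card := fun ξ h => (Finset.mem_filter.1 h).2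
  have hΞ0 : ∀ ξ ∈ Ξ, ξ ≠ 0 := by
    rintro ξ hξ rfl
    have := hΞN 0 hξ
    rw [fib_zero A h0, Finset.card_empty] at this
    omega
  have hΞi : ∀ ξ ∈ Ξ, ξ⁻¹ ∈ Ξ := by
    intro ξ hξ
    refine Finset.mem_filter.2 ⟨Finset.mem_univ _, ?_⟩
    rw [fib_inv A ξ (hΞ0 ξ hξ)]
    exact hΞN ξ hξ
  have hen : e ≤ n ^ 2 := (e_le A Ξ h0).trans (Nat.pow_le_pow_left hn 2)
  set M := max (max ((S:ℝ) ^ ((7:ℝ)/4) * n) ((n:ℝ) ^ 2 * D))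
        ((S:ℝ) ^ ((7:ℝ)/4) * (n:ℝ) ^ ((3:ℝ)/2) * (q : ℝ) ^ (-(1:ℝ)/4)) with hM
  have hM1 : (S:ℝ) ^ ((7:ℝ)/4) * n ≤ M := (le_max_left _ _).trans (le_max_left _ _)
  have hM2 : (n:ℝ) ^ 2 * D ≤ M := (le_max_right _ _).trans (le_max_left _ _)
  have hM3 : (S:ℝ) ^ ((7:ℝ)/4) * (n:ℝ) ^ ((3:ℝ)/2) * (q : ℝ) ^ (-(1:ℝ)/4) ≤ M :=
    le_max_right _ _
  have hM0 : 0 ≤ M := le_trans (by positivity) hM1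
  have hS0 : (0:ℝ) ≤ S := Nat.cast_nonneg S
  have hnR : (0:ℝ) < n := by exact_mod_cast hn0
  have hy4 : ((S:ℝ) ^ ((7:ℝ)/4) * n) ^ 4 = (S:ℝ) ^ 7 * (n:ℝ) ^ 4 := by
    rw [mul_pow, pow_four_nat _ _ 7 hS0 (by norm_num)]
  -- reduction to a fourth power bound
  have key : ∀ K : ℝ, 1 ≤ K → K ≤ 2097152 * (1 + C ^ 2) →
      ((e:ℝ) * N) ^ 4 ≤ K * ((S:ℝ) ^ 7 * (n:ℝ) ^ 4) →
      (e:ℝ) * N ≤ (2097152 * (1 + C ^ 2) + 2 * C) * M := by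
    intro K hK1 hK h
    rw [← hy4] at h
    have h1 := root_four _ _ K (by positivity) hK1 h
    refine h1.trans ?_
    have : K ≤ 2097152 * (1 + C ^ 2) + 2 * C := by linarith
    gcongr
  by_cases hbig : (e * N) ^ 4 ≤ 2097152 * (S ^ 7 * n ^ 4)
  · apply key 2097152 (by norm_num) (by nlinarith [sq_nonneg C])
    exact_mod_cast hbig
  push Not at hbig
  have hi : 64 * S ^ 4 * Q * n ^ 2 < e ^ 2 * N ^ 4 := by
    have h1 : 64 * S ^ 4 * Q * n ^ 2 ≤ 2097152 * S ^ 7 := by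
      calc 64 * S ^ 4 * Q * n ^ 2 = 64 * S ^ 4 * (Q * n ^ 2) := by ring
        _ ≤ 64 * S ^ 4 * (4096 * S ^ 3) := by gcongr
        _ = 262144 * S ^ 7 := by ring
        _ ≤ _ := by gcongr; norm_num
    have h2 : 2097152 * S ^ 7 * n ^ 4 < e ^ 2 * N ^ 4 * n ^ 4 := by
      calc _ = 2097152 * (S ^ 7 * n ^ 4) := by ring
        _ < (e * N) ^ 4 := hbig
        _ = e ^ 2 * N ^ 4 * e ^ 2 := by ring
        _ ≤ e ^ 2 * N ^ 4 * (n ^ 2) ^ 2 := by gcongr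
        _ = _ := by ring
    exact h1.trans_lt (Nat.lt_of_mul_lt_mul_right h2)
  have hii : 512 * S ^ 4 * Q * n ^ 4 < e ^ 3 * N ^ 4 := by
    have h1 : 512 * S ^ 4 * Q * n ^ 4 ≤ 2097152 * S ^ 7 * n ^ 2 := by
      calc 512 * S ^ 4 * Q * n ^ 4 = 512 * S ^ 4 * (Q * n ^ 2) * n ^ 2 := by ring
        _ ≤ 512 * S ^ 4 * (4096 * S ^ 3) * n ^ 2 := by gcongr
        _ = 2097152 * S ^ 7 * n ^ 2 := by ring
    have h2 : 2097152 * S ^ 7 * n ^ 2 * n ^ 2 < e ^ 3 * N ^ 4 * n ^ 2 := by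
      calc _ = 2097152 * (S ^ 7 * n ^ 4) := by ring
        _ < (e * N) ^ 4 := hbig
        _ = e ^ 3 * N ^ 4 * e := by ring
        _ ≤ e ^ 3 * N ^ 4 * n ^ 2 := by gcongr
    exact h1.trans_lt (Nat.lt_of_mul_lt_mul_right h2)
  have he0 : 0 < e := by
    rcases Nat.eq_zero_or_pos e with h | h
    · rw [h] at hi; simp at hi
    · exact h
  obtain ⟨G, Y, y₀, hYA, hYe, hYG, hYN⟩ :=
    core A Ξ σ h0 hσ N S n e hn hS hΞ0 hΞi hΞN hN he hi hii
  set m := Y.card with hm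
  have hm0 : 0 < m := by
    rcases Nat.eq_zero_or_pos m with h | h
    · rw [h] at hYe; omega
    · exact h
  have hNn : (N:ℝ) ≤ n := by
    obtain ⟨ξ, hξ⟩ : Ξ.Nonempty := by
      rw [Finset.nonempty_iff_ne_empty]
      intro h
      rw [he, h, Finset.sum_empty] at he0
      omega
    exact_mod_cast (hΞN ξ hξ).trans (hfn ξ)
  have hYe' : (e:ℝ) ≤ 2 * n * m := by exact_mod_cast hYe
  have hen' : (e:ℝ) ≤ (n:ℝ) ^ 2 := by exact_mod_cast hen
  have hQ' : (Q:ℝ) * (n:ℝ) ^ 2 ≤ 4096 * (S:ℝ) ^ 3 := by exact_mod_cast hQ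
  -- a good dilate in the field
  let GF : Finset F := Finset.univ.filter (· ∈ G)
  have hGF : (GF.card : ℕ) = Nat.card G := by
    rw [Nat.card_eq_fintype_card, Fintype.card_subtype]
  have hGne : GF.Nonempty := ⟨0, by simp [GF, G.zero_mem]⟩
  obtain ⟨r, hr, hexp⟩ := expand Y GF hm0 hGne
  have hrG : r ∈ G := (Finset.mem_filter.1 hr).2
  have hT := hYN r hrG
  set T := (Y + r • Y).card with hTdef
  have hT' : (T:ℝ) * (N:ℝ) ^ 4 ≤ (S:ℝ) ^ 4 * Q := by exact_mod_cast hT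
  have hexp' : (m:ℝ) ^ 2 * GF.card ≤ T * (GF.card + (m:ℝ) ^ 2) := by exact_mod_cast hexp
  have hg : (0:ℝ) < GF.card := by exact_mod_cast hGne.card_pos
  have small : ∀ κ : ℝ, 1 ≤ κ → κ ≤ 2 * (1 + C ^ 2) → (m:ℝ) ^ 2 ≤ κ * T →
      (e:ℝ) * N ≤ (2097152 * (1 + C ^ 2) + 2 * C) * M := by
    intro κ hκ1 hκ h
    refine key (16384 * κ) (by linarith) (by nlinarith [sq_nonneg C]) ?_
    exact small_case e N n m T S Q κ (Nat.cast_nonneg _) hnR (Nat.cast_nonneg _) hS0 hκ1 hen'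
      hYe' h hT' hQ'
  by_cases hGtop : G = ⊤
  · -- the whole field
    have hgq : GF.card = q := by
      simp [GF, hGtop, hq]
    rw [hgq] at hexp' hg
    by_cases hmq : (m:ℝ) ^ 2 ≤ q
    · apply small 2 (by norm_num) (by nlinarith [sq_nonneg C])
      have h1 : (m:ℝ) ^ 2 * q ≤ (2 * T) * q := by
        have : (T:ℝ) * (q + (m:ℝ) ^ 2) ≤ T * (q + q) := by gcongr
        linarith
      exact le_of_mul_le_mul_right h1 hg
    · push Not at hmq
      have hm2 : (0:ℝ) < (m:ℝ) ^ 2 := by positivity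
      have hqT : (q:ℝ) ≤ 2 * T := by
        have h1 : (q:ℝ) * (m:ℝ) ^ 2 ≤ (2 * T) * (m:ℝ) ^ 2 := by
          have : (T:ℝ) * (q + (m:ℝ) ^ 2) ≤ T * ((m:ℝ) ^ 2 + (m:ℝ) ^ 2) := by gcongr
          linarith
        exact le_of_mul_le_mul_right h1 hm2
      have h4 : ((S:ℝ) ^ ((7:ℝ)/4) * (n:ℝ) ^ ((3:ℝ)/2) * (q : ℝ) ^ (-(1:ℝ)/4)) ^ 4 =
          (S:ℝ) ^ 7 * (n:ℝ) ^ 6 * (q:ℝ)⁻¹ := by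
        rw [mul_pow, mul_pow, pow_four_nat _ _ 7 hS0 (by norm_num),
          pow_four_nat _ _ 6 hnR.le (by norm_num), pow_four _ _ (-1) hg.le (by norm_num),
          Real.rpow_neg_one]
      have h5 : ((e:ℝ) * N) ^ 4 ≤ 8192 *
          ((S:ℝ) ^ ((7:ℝ)/4) * (n:ℝ) ^ ((3:ℝ)/2) * (q : ℝ) ^ (-(1:ℝ)/4)) ^ 4 := by
        rw [h4, ← mul_assoc 8192, ← div_eq_mul_inv, le_div_iff₀ hg]
        exact large_case e N n T S Q q (Nat.cast_nonneg _) (Nat.cast_nonneg _)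
          hS0 hg.le hen' hqT hT' hQ'
      have h6 := root_four _ _ 8192 (by positivity) (by norm_num) h5
      refine h6.trans ?_
      have : (8192:ℝ) ≤ 2097152 * (1 + C ^ 2) + 2 * C := by nlinarith [sq_nonneg C]
      gcongr
  · -- a proper subfield
    have hmle : (m:ℝ) ≤ C * max ((Nat.card G : ℝ) ^ ((1:ℝ)/2)) D := by
      refine le_trans ?_ (hsub G hGtop y₀)
      have : Y ⊆ A.filter fun x => ∃ g ∈ G, x = y₀ * g := by
        intro y hy
        exact Finset.mem_filter.2 ⟨hYA hy, hYG y hy⟩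
      exact_mod_cast Finset.card_le_card this
    rcases le_total D ((Nat.card G : ℝ) ^ ((1:ℝ)/2)) with hD | hD
    · rw [max_eq_left hD, ← hGF] at hmle
      apply small (1 + C ^ 2) (by nlinarith [sq_nonneg C]) (by nlinarith [sq_nonneg C])
      have hsq : (m:ℝ) ^ 2 ≤ C ^ 2 * GF.card := by
        calc (m:ℝ) ^ 2 ≤ (C * (GF.card : ℝ) ^ ((1:ℝ)/2)) ^ 2 :=
              pow_le_pow_left₀ (Nat.cast_nonneg _) hmle 2
          _ = C ^ 2 * GF.card := by
              rw [mul_pow, ← Real.sqrt_eq_rpow, Real.sq_sqrt hg.le]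
      have h1 : (m:ℝ) ^ 2 * GF.card ≤ ((1 + C ^ 2) * T) * GF.card := by
        have : (T:ℝ) * (GF.card + (m:ℝ) ^ 2) ≤ T * (GF.card + C ^ 2 * GF.card) := by gcongr
        linarith
      exact le_of_mul_le_mul_right h1 hg
    · rw [max_eq_right hD] at hmle
      calc (e:ℝ) * N ≤ (2 * n * m) * n := by gcongr
        _ = 2 * (n:ℝ) ^ 2 * m := by ring
        _ ≤ 2 * (n:ℝ) ^ 2 * (C * D) := by gcongr
        _ = 2 * C * ((n:ℝ) ^ 2 * D) := by ring
        _ ≤ 2 * C * M := by gcongr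
        _ ≤ _ := by
          have : 0 ≤ 2097152 * (1 + C ^ 2) * M := by positivity
          linarith

set_option maxHeartbeats 1000000 in
lemma induct [Fintype F] (A : Finset F) (σ : F) (h0 : (0:F) ∉ A)
    (hσ : σ = 1 ∨ σ = -1) (C D : ℝ) (hC : 0 < C) (hD : 0 ≤ D)
    (hsub : ∀ G : Subfield F, G ≠ ⊤ → ∀ c : F,
      ((A.filter fun x => ∃ g ∈ G, x = c * g).card : ℝ) ≤
        C * max ((Nat.card G : ℝ) ^ ((1:ℝ)/2)) D) (k : ℕ) :
    ∀ R ⊆ A, R.card ≤ k → (mulEnergy R : ℝ) ≤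
      16 * ((1 + Real.log A.card) * ((2097152 * (1 + C ^ 2) + 2 * C) *
      (max (max (((A + σ • A).card:ℝ) ^ ((7:ℝ)/4)) ((A.card:ℝ) * D))
        (((A + σ • A).card:ℝ) ^ ((7:ℝ)/4) * (A.card:ℝ) ^ ((1:ℝ)/2) *
          (Fintype.card F : ℝ) ^ (-(1:ℝ)/4)) * R.card))) := by
  set S := (A + σ • A).card with hS
  set q := Fintype.card F with hq
  set W := max (max ((S:ℝ) ^ ((7:ℝ)/4)) ((A.card:ℝ) * D))
        ((S:ℝ) ^ ((7:ℝ)/4) * (A.card:ℝ) ^ ((1:ℝ)/2) * (q : ℝ) ^ (-(1:ℝ)/4)) with hW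
  have hW1 : (S:ℝ) ^ ((7:ℝ)/4) ≤ W := (le_max_left _ _).trans (le_max_left _ _)
  have hW2 : (A.card:ℝ) * D ≤ W := (le_max_right _ _).trans (le_max_left _ _)
  have hW3 : (S:ℝ) ^ ((7:ℝ)/4) * (A.card:ℝ) ^ ((1:ℝ)/2) * (q : ℝ) ^ (-(1:ℝ)/4) ≤ W :=
    le_max_right _ _
  have hW0 : 0 ≤ W := le_trans (by positivity) hW1
  set L := 1 + Real.log A.card with hLdef
  have hL : 0 ≤ L := by
    have : 0 ≤ Real.log A.card := Real.log_natCast_nonneg _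
    linarith
  set K := 2097152 * (1 + C ^ 2) + 2 * C with hK
  have hK0 : 0 ≤ K := by positivity
  induction k using Nat.strong_induction_on with
  | _ k ih =>
  intro R hRA hRk
  rcases Nat.eq_zero_or_pos R.card with hR0 | hR0
  · have : R = ∅ := Finset.card_eq_zero.1 hR0
    subst this
    simp [mulEnergy]
  obtain ⟨R', hR'R, hdiff, hpl⟩ := plun_large R (σ • R) S
    (Finset.card_le_card (Finset.add_subset_add hRA (Finset.smul_finset_subset_smul_finset hRA)))
  have hR'A : R' ⊆ A := hR'R.trans hRA
  have hs : σ • R' ⊆ σ • R := Finset.smul_finset_subset_smul_finset hR'R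
  have hmono : (R' + σ • R' + σ • R' + σ • R').card ≤ (R' + σ • R + σ • R + σ • R).card :=
    Finset.card_le_card (Finset.add_subset_add (Finset.add_subset_add
      (Finset.add_subset_add (Finset.Subset.refl _) hs) hs) hs)
  have h1 := main_prop R' σ (fun h => h0 (hR'A h)) hσ S R.card hR0 (Finset.card_le_card hR'R)
    (Finset.card_le_card (Finset.add_subset_add hR'A
      (Finset.smul_finset_subset_smul_finset hR'A)))
    ((Nat.mul_le_mul_right _ hmono).trans hpl) C D hC (by
      intro G hG c
      refine le_trans ?_ (hsub G hG c)
      exact_mod_cast Finset.card_le_card (Finset.filter_subset_filter _ hR'A))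
  have h2 := ih (R \ R').card (by omega) (R \ R') (Finset.sdiff_subset.trans hRA) le_rfl
  have h3 : (mulEnergy R : ℝ) ≤ 8 * mulEnergy R' + 8 * mulEnergy (R \ R') := by
    have := energy_union R' (R \ R') (fun h => h0 (hR'A h))
      (fun h => h0 (hRA (Finset.sdiff_subset h)))
    rw [Finset.union_sdiff_of_subset hR'R] at this
    exact_mod_cast this
  have hRn : (R.card:ℝ) ≤ A.card := by exact_mod_cast Finset.card_le_card hRA
  have hRpos : (0:ℝ) < R.card := by exact_mod_cast hR0
  have hlog : 1 + Real.log R.card ≤ L := by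
    have := Real.log_le_log hRpos hRn
    linarith
  have hlog0 : 0 ≤ 1 + Real.log R.card := by
    have : 0 ≤ Real.log R.card := Real.log_natCast_nonneg _
    linarith
  have hmax : max (max ((S:ℝ) ^ ((7:ℝ)/4) * R.card) ((R.card:ℝ) ^ 2 * D))
        ((S:ℝ) ^ ((7:ℝ)/4) * (R.card:ℝ) ^ ((3:ℝ)/2) * (q : ℝ) ^ (-(1:ℝ)/4)) ≤ W * R.card := by
    refine max_le (max_le ?_ ?_) ?_
    · gcongr
    · calc (R.card:ℝ) ^ 2 * D = R.card * D * R.card := by ring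
        _ ≤ A.card * D * R.card := by gcongr
        _ ≤ W * R.card := by gcongr
    · have e1 : (R.card:ℝ) ^ ((3:ℝ)/2) = (R.card:ℝ) ^ ((1:ℝ)/2) * R.card := by
        rw [← Real.rpow_add_one hRpos.ne']
        norm_num
      calc (S:ℝ) ^ ((7:ℝ)/4) * (R.card:ℝ) ^ ((3:ℝ)/2) * (q : ℝ) ^ (-(1:ℝ)/4)
          = (S:ℝ) ^ ((7:ℝ)/4) * (R.card:ℝ) ^ ((1:ℝ)/2) * (q : ℝ) ^ (-(1:ℝ)/4) * R.card := by
            rw [e1]; ring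
        _ ≤ (S:ℝ) ^ ((7:ℝ)/4) * (A.card:ℝ) ^ ((1:ℝ)/2) * (q : ℝ) ^ (-(1:ℝ)/4) * R.card := by
            gcongr
        _ ≤ W * R.card := by gcongr
  have h4 : (mulEnergy R' : ℝ) ≤ L * (K * (W * R.card)) := by
    refine h1.trans ?_
    gcongr
  have hd : 16 * ((R \ R').card : ℝ) ≤ R.card := by exact_mod_cast hdiff
  have h5 : (mulEnergy (R \ R') : ℝ) ≤ L * (K * (W * R.card)) := by
    refine h2.trans ?_
    calc _ = L * (K * (W * (16 * ((R \ R').card : ℝ)))) := by ring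
      _ ≤ _ := by gcongr
  linarith

lemma final_bound [Fintype F] (A : Finset F) (σ : F) (h0 : (0:F) ∉ A) (hA : 2 ≤ A.card)
    (hσ : σ = 1 ∨ σ = -1) (C δ : ℝ) (hC : 0 < C) (hδ : 0 < δ)
    (hsub : ∀ G : Subfield F, G ≠ ⊤ → ∀ c : F,
      ((A.filter fun x => ∃ g ∈ G, x = c * g).card : ℝ) ≤
        C * max ((Nat.card G : ℝ) ^ ((1:ℝ)/2)) ((A.card : ℝ) ^ ((1:ℝ) - δ))) :
    (mulEnergy A : ℝ) ≤
      (48 * (2097152 * (1 + C ^ 2) + 2 * C)) * Real.log (A.card : ℝ) *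
        max (max (((A + σ • A).card : ℝ) ^ ((7:ℝ)/4) * (A.card : ℝ))
            (((A + σ • A).card : ℝ) ^ ((6:ℝ)/5) * (A.card : ℝ) ^ ((8:ℝ)/5)))
          (max ((A.card : ℝ) ^ ((3:ℝ) - δ/2))
            (((A + σ • A).card : ℝ) ^ ((7:ℝ)/4) * (A.card : ℝ) ^ ((3:ℝ)/2) *
              (Fintype.card F : ℝ) ^ (-(1:ℝ)/4))) := by
  have h := induct A σ h0 hσ C ((A.card : ℝ) ^ ((1:ℝ) - δ)) hC (by positivity) hsub A.card A
    (Finset.Subset.refl _) le_rfl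
  set S := (A + σ • A).card with hS
  set q := Fintype.card F with hq
  set K := 2097152 * (1 + C ^ 2) + 2 * C with hK
  have hK0 : 0 ≤ K := by positivity
  have hn2 : (2:ℝ) ≤ A.card := by exact_mod_cast hA
  set n : ℝ := (A.card : ℝ) with hn
  have hn0 : 0 < n := by linarith
  set M := max (max ((S : ℝ) ^ ((7:ℝ)/4) * n) ((S : ℝ) ^ ((6:ℝ)/5) * n ^ ((8:ℝ)/5)))
          (max (n ^ ((3:ℝ) - δ/2))
            ((S : ℝ) ^ ((7:ℝ)/4) * n ^ ((3:ℝ)/2) * (q : ℝ) ^ (-(1:ℝ)/4))) with hM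
  have hM1 : (S : ℝ) ^ ((7:ℝ)/4) * n ≤ M := (le_max_left _ _).trans (le_max_left _ _)
  have hM2 : n ^ ((3:ℝ) - δ/2) ≤ M := (le_max_left _ _).trans (le_max_right _ _)
  have hM3 : (S : ℝ) ^ ((7:ℝ)/4) * n ^ ((3:ℝ)/2) * (q : ℝ) ^ (-(1:ℝ)/4) ≤ M :=
    (le_max_right _ _).trans (le_max_right _ _)
  have hM0 : 0 ≤ M := le_trans (by positivity) hM1
  have hlog : 1 + Real.log n ≤ 3 * Real.log n := by
    have h1 := Real.log_le_log (by norm_num) hn2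
    have h2 := Real.log_two_gt_d9
    linarith
  have hlog0 : 0 ≤ 1 + Real.log n := by
    have : 0 ≤ Real.log n := Real.log_nonneg (by linarith)
    linarith
  have hW : max (max ((S:ℝ) ^ ((7:ℝ)/4)) (n * n ^ ((1:ℝ) - δ)))
        ((S:ℝ) ^ ((7:ℝ)/4) * n ^ ((1:ℝ)/2) * (q : ℝ) ^ (-(1:ℝ)/4)) * n ≤ M := by
    rw [max_mul_of_nonneg _ _ hn0.le, max_mul_of_nonneg _ _ hn0.le]
    refine max_le (max_le hM1 ?_) ?_
    · refine le_trans ?_ hM2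
      have : n * n ^ ((1:ℝ) - δ) * n = n ^ ((3:ℝ) - δ) := by
        rw [mul_comm n, ← Real.rpow_add_one hn0.ne', ← Real.rpow_add_one hn0.ne']
        congr 1; ring
      rw [this]
      exact Real.rpow_le_rpow_of_exponent_le (by linarith) (by linarith)
    · refine le_trans (le_of_eq ?_) hM3
      have e1 : n ^ ((3:ℝ)/2) = n ^ ((1:ℝ)/2) * n := by
        rw [← Real.rpow_add_one hn0.ne']
        norm_num
      rw [e1]; ring
  refine h.trans ?_
  calc _ ≤ 16 * ((3 * Real.log n) * (K * M)) := by gcongr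
    _ = _ := by ring


theorem stmt14 : ∀ C δ : ℝ, 0 < C → 0 < δ → ∃ C' : ℝ, 0 < C' ∧
    ∀ (F : Type) [Field F] [Fintype F] (q : ℕ), IsPrimePow q → Fintype.card F = q →
    ∀ A : Finset F, 2 ≤ A.card → (0:F) ∉ A →
    (∀ G : Subfield F, G ≠ ⊤ → ∀ c : F,
      ((A.filter fun x => ∃ g ∈ G, x = c * g).card : ℝ) ≤
        C * max ((Nat.card G : ℝ) ^ ((1:ℝ)/2)) ((A.card : ℝ) ^ ((1:ℝ) - δ))) →
    (mulEnergy A : ℝ) ≤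
      C' * Real.log (A.card : ℝ) *
        max (max (((A + A).card : ℝ) ^ ((7:ℝ)/4) * (A.card : ℝ))
            (((A + A).card : ℝ) ^ ((6:ℝ)/5) * (A.card : ℝ) ^ ((8:ℝ)/5)))
          (max ((A.card : ℝ) ^ ((3:ℝ) - δ/2))
            (((A + A).card : ℝ) ^ ((7:ℝ)/4) * (A.card : ℝ) ^ ((3:ℝ)/2) * (q : ℝ) ^ (-(1:ℝ)/4))) ∧
    (mulEnergy A : ℝ) ≤
      C' * Real.log (A.card : ℝ) *
        max (max (((A - A).card : ℝ) ^ ((7:ℝ)/4) * (A.card : ℝ))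
            (((A - A).card : ℝ) ^ ((6:ℝ)/5) * (A.card : ℝ) ^ ((8:ℝ)/5)))
          (max ((A.card : ℝ) ^ ((3:ℝ) - δ/2))
            (((A - A).card : ℝ) ^ ((7:ℝ)/4) * (A.card : ℝ) ^ ((3:ℝ)/2) * (q : ℝ) ^ (-(1:ℝ)/4))) := by
  intro C δ hC hδ
  refine ⟨48 * (2097152 * (1 + C ^ 2) + 2 * C), by positivity, ?_⟩
  intro F _ _ q _ hq A hA h0 hsub
  subst hq
  have h1 := final_bound A 1 h0 hA (Or.inl rfl) C δ hC hδ hsub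
  have h2 := final_bound A (-1) h0 hA (Or.inr rfl) C δ hC hδ hsub
  have e1 : A + (1:F) • A = A + A := by rw [one_smul]
  have e2 : A + (-1:F) • A = A - A := by
    rw [sub_eq_add_neg]
    congr 1
    ext x
    simp [Finset.mem_smul_finset, Finset.mem_neg]
  rw [e1] at h1
  rw [e2] at h2
  exact ⟨h1, h2⟩

end STP
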